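/- arXiv:1809.02038 — 8 statements merged into one kernel-verified Lean document; each statement's English description precedes it below -/
import Mathlib

section
/- Let H ∈ (1/2,1). For all s, t > 0, the double Lebesgue integral ∫₀^t ∫₀^s H(2H−1)(|r−u|^{2H−2} − (r+u)^{2H−2}) du dr equals R_H(s,t) = s^{2H} + t^{2H} − (1/2)(|t−s|^{2H} + (t+s)^{2H}). In particular the kernel K_H(u,r) = H(2H−1)(|u−r|^{2H−2} − (u+r)^{2H−2}) integrates to the sub-fractional covariance. -/
open Real MeasureTheory intervalIntegral

theorem intervalIntegrable_abs_rpow {p : ℝ} (hp : -1 < p) (a b : ℝ) :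
    IntervalIntegrable (fun x : ℝ => |x| ^ p) volume a b := by
  refine intervalIntegrable_of_even (fun x => by rw [abs_neg]) fun c hc => ?_
  refine (intervalIntegrable_rpow' hp).congr (f := fun x => x ^ p) fun x hx => ?_
  rw [Set.uIoc_of_le hc.le] at hx
  simp only [abs_of_pos hx.1]

theorem intervalIntegrable_sign_mul_abs_rpow {q : ℝ} (hq : -1 < q) (a b : ℝ) :
    IntervalIntegrable (fun x : ℝ => Real.sign x * |x| ^ q) volume a b := by
  refine intervalIntegrable_of_odd (fun x => by rw [abs_neg, Real.sign_neg, neg_mul])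
    fun c hc => ?_
  refine (intervalIntegrable_rpow' hq).congr (f := fun x => x ^ q) fun x hx => ?_
  rw [Set.uIoc_of_le hc.le] at hx
  simp only [abs_of_pos hx.1, Real.sign_of_pos hx.1, one_mul]

theorem integral_zero_abs_rpow {p : ℝ} (hp : -1 < p) (c : ℝ) :
    ∫ x in (0 : ℝ)..c, |x| ^ p = Real.sign c * |c| ^ (p + 1) / (p + 1) := by
  have hpos : ∀ d : ℝ, 0 ≤ d → ∫ x in (0 : ℝ)..d, |x| ^ p = d ^ (p + 1) / (p + 1) := by
    intro d hd
    have : ∫ x in (0 : ℝ)..d, |x| ^ p = ∫ x in (0 : ℝ)..d, x ^ p :=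
      integral_congr fun x hx => by
        rw [Set.uIcc_of_le hd] at hx
        simp only [abs_of_nonneg hx.1]
    rw [this, integral_rpow (Or.inl hp), Real.zero_rpow (by linarith), sub_zero]
  rcases lt_trichotomy c 0 with hc | rfl | hc
  · have h := integral_comp_neg (a := c) (b := 0) fun x : ℝ => |x| ^ p
    simp only [abs_neg, neg_zero] at h
    rw [integral_symm, h, hpos _ (by linarith), Real.sign_of_neg hc, abs_of_neg hc]
    ring
  · simp
  · rw [hpos c hc.le, Real.sign_of_pos hc, abs_of_pos hc, one_mul]

theorem integral_zero_sign_mul_abs_rpow {q : ℝ} (hq : -1 < q) (c : ℝ) :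
    ∫ x in (0 : ℝ)..c, Real.sign x * |x| ^ q = |c| ^ (q + 1) / (q + 1) := by
  have hpos : ∀ d : ℝ, 0 ≤ d →
      ∫ x in (0 : ℝ)..d, Real.sign x * |x| ^ q = d ^ (q + 1) / (q + 1) := by
    intro d hd
    have : ∫ x in (0 : ℝ)..d, Real.sign x * |x| ^ q = ∫ x in (0 : ℝ)..d, x ^ q :=
      integral_congr_ae <| .of_forall fun x hx => by
        rw [Set.uIoc_of_le hd] at hx
        simp only [abs_of_pos hx.1, Real.sign_of_pos hx.1, one_mul]
    rw [this, integral_rpow (Or.inl hq), Real.zero_rpow (by linarith), sub_zero]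
  rcases le_total 0 c with hc | hc
  · rw [hpos c hc, abs_of_nonneg hc]
  · have h := integral_comp_neg (a := c) (b := 0) fun x : ℝ => Real.sign x * |x| ^ q
    simp only [abs_neg, neg_zero, Real.sign_neg, neg_mul, intervalIntegral.integral_neg] at h
    rw [integral_symm, h, hpos _ (by linarith), abs_of_nonpos hc]

theorem integral_abs_sub_rpow_sub_add_rpow {p r : ℝ} (hp : -1 < p) (hr : 0 < r) (s : ℝ) :
    ∫ u in (0 : ℝ)..s, (|r - u| ^ p - (r + u) ^ p)
      = (2 * r ^ (p + 1) - Real.sign (r - s) * |r - s| ^ (p + 1) - (r + s) ^ (p + 1))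
        / (p + 1) := by
  have hi₁ : IntervalIntegrable (fun u : ℝ => |r - u| ^ p) volume 0 s := by
    simpa using (intervalIntegrable_abs_rpow hp r (r - s)).comp_sub_left r
  have hi₂ : IntervalIntegrable (fun u : ℝ => (r + u) ^ p) volume 0 s := by
    simpa using (intervalIntegrable_rpow' (a := r) (b := r + s) hp).comp_add_left r
  rw [integral_sub hi₁ hi₂, integral_comp_sub_left (fun x : ℝ => |x| ^ p),
    integral_comp_add_left (fun x : ℝ => x ^ p), integral_rpow (Or.inl hp), sub_zero, add_zero,
    ← integral_interval_sub_left (intervalIntegrable_abs_rpow hp 0 r)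
      (intervalIntegrable_abs_rpow hp 0 (r - s)),
    integral_zero_abs_rpow hp, integral_zero_abs_rpow hp, Real.sign_of_pos hr, abs_of_pos hr]
  ring

theorem sfbm_kernel_integrates_to_cov (H : ℝ) (hH : H ∈ Set.Ioo (1 / 2 : ℝ) 1)
    (s t : ℝ) (hs : 0 < s) (ht : 0 < t) :
    (∫ r in (0 : ℝ)..t, ∫ u in (0 : ℝ)..s,
        H * (2 * H - 1) * (|r - u| ^ (2 * H - 2) - (r + u) ^ (2 * H - 2)))
      = s ^ (2 * H) + t ^ (2 * H)
        - (1 / 2) * (|t - s| ^ (2 * H) + (t + s) ^ (2 * H)) := by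
  have hH₁ : 1 / 2 < H := hH.1
  have hp : -1 < 2 * H - 2 := by linarith
  have hq : -1 < 2 * H - 1 := by linarith
  have hq₀ : 2 * H - 1 ≠ 0 := by linarith
  have hp₁ : 2 * H - 2 + 1 = 2 * H - 1 := by ring
  have hq₁ : 2 * H - 1 + 1 = 2 * H := by ring
  have inner : (∫ r in (0 : ℝ)..t, ∫ u in (0 : ℝ)..s,
        H * (2 * H - 1) * (|r - u| ^ (2 * H - 2) - (r + u) ^ (2 * H - 2)))
      = ∫ r in (0 : ℝ)..t, H * (2 * r ^ (2 * H - 1)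
          - Real.sign (r - s) * |r - s| ^ (2 * H - 1) - (r + s) ^ (2 * H - 1)) :=
    integral_congr_ae <| .of_forall fun r hr => by
      rw [Set.uIoc_of_le ht.le] at hr
      rw [intervalIntegral.integral_const_mul, integral_abs_sub_rpow_sub_add_rpow hp hr.1, hp₁,
        mul_assoc, mul_div_cancel₀ _ hq₀]
  have hi₁ : IntervalIntegrable (fun r : ℝ => 2 * r ^ (2 * H - 1)) volume 0 t :=
    (intervalIntegrable_rpow' hq).const_mul 2
  have hi₂ : IntervalIntegrable (fun r : ℝ => Real.sign (r - s) * |r - s| ^ (2 * H - 1))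
      volume 0 t := by
    simpa using (intervalIntegrable_sign_mul_abs_rpow hq (0 - s) (t - s)).comp_sub_right s
  have hi₃ : IntervalIntegrable (fun r : ℝ => (r + s) ^ (2 * H - 1)) volume 0 t := by
    simpa using (intervalIntegrable_rpow' (a := 0 + s) (b := t + s) hq).comp_add_right s
  rw [inner, intervalIntegral.integral_const_mul, integral_sub (hi₁.sub hi₂) hi₃,
    integral_sub hi₁ hi₂, intervalIntegral.integral_const_mul,
    integral_comp_sub_right (fun x : ℝ => Real.sign x * |x| ^ (2 * H - 1)),
    integral_comp_add_right (fun x : ℝ => x ^ (2 * H - 1)),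
    ← integral_interval_sub_left (intervalIntegrable_sign_mul_abs_rpow hq 0 (t - s))
      (intervalIntegrable_sign_mul_abs_rpow hq 0 (0 - s)),
    integral_zero_sign_mul_abs_rpow hq, integral_zero_sign_mul_abs_rpow hq,
    integral_rpow (Or.inl hq), integral_rpow (Or.inl hq), hq₁, zero_sub, abs_neg, abs_of_pos hs,
    zero_add, Real.zero_rpow (by linarith)]
  field_simp
  ring
end

section
/- Let H ∈ (1/2,1) and t > 0. If f : [0,t] → ℝ is measurable with ∫₀^t f(r)² dr < ∞, then ∫₀^t s^{3−2H} (∫_s^t |f(r)| (r² − s²)^{H−3/2} dr)² ds < ∞. In other words, L²([0,t]) is contained in the space Λ_t^{H−1/2}. -/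
open Real MeasureTheory ENNReal

/-- Cauchy–Schwarz for the lower Lebesgue integral, with one factor split as a weight. -/
theorem sq_lintegral_mul_le_lintegral_mul_lintegral_sq_mul {α : Type*} [MeasurableSpace α]
    (μ : Measure α) {g k : α → ℝ≥0∞} (hg : Measurable g) (hk : Measurable k) :
    (∫⁻ x, g x * k x ∂μ) ^ 2 ≤ (∫⁻ x, k x ∂μ) * ∫⁻ x, g x ^ 2 * k x ∂μ := by
  have hsq : ∀ x : ℝ≥0∞, (x ^ (1 / 2 : ℝ)) ^ 2 = x := fun x => by
    rw [← ENNReal.rpow_natCast, ← ENNReal.rpow_mul]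
    norm_num
  have h := ENNReal.lintegral_mul_le_Lp_mul_Lq μ Real.HolderConjugate.two_two
    (f := fun x => k x ^ (1 / 2 : ℝ)) (g := fun x => g x * k x ^ (1 / 2 : ℝ))
    (hk.pow_const _).aemeasurable (hg.mul (hk.pow_const _)).aemeasurable
  have hprod : ∀ x, k x ^ (1 / 2 : ℝ) * (g x * k x ^ (1 / 2 : ℝ)) = g x * k x := fun x => by
    rw [mul_left_comm, ← sq, hsq]
  simp only [Pi.mul_apply, hprod, ENNReal.rpow_two, mul_pow, hsq] at h
  calc (∫⁻ x, g x * k x ∂μ) ^ 2 ≤ _ := pow_le_pow_left' h 2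
    _ = _ := by rw [mul_pow, hsq, hsq]

/-- Young's inequality `‖g ∗ k‖₂ ≤ ‖k‖₁ ‖g‖₂`, squared, for nonnegative functions. -/
theorem lintegral_sq_lintegral_mul_sub_le {g k : ℝ → ℝ≥0∞}
    (hg : Measurable g) (hk : Measurable k) :
    ∫⁻ s, (∫⁻ r, g r * k (r - s)) ^ 2 ≤ (∫⁻ u, k u) ^ 2 * ∫⁻ r, g r ^ 2 := by
  calc ∫⁻ s, (∫⁻ r, g r * k (r - s)) ^ 2
      ≤ ∫⁻ s, (∫⁻ u, k u) * ∫⁻ r, g r ^ 2 * k (r - s) := by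
        refine lintegral_mono fun s => ?_
        have h := sq_lintegral_mul_le_lintegral_mul_lintegral_sq_mul volume hg
          (hk.comp (measurable_id.sub_const s))
        simpa only [Function.comp_def, id, lintegral_sub_right_eq_self k s] using h
    _ = (∫⁻ u, k u) * ∫⁻ s, ∫⁻ r, g r ^ 2 * k (r - s) :=
        lintegral_const_mul _ (Measurable.lintegral_prod_right' (f := fun p : ℝ × ℝ =>
          g p.2 ^ 2 * k (p.2 - p.1)) (by fun_prop))
    _ = (∫⁻ u, k u) * ∫⁻ r, ∫⁻ s, g r ^ 2 * k (r - s) := by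
        rw [lintegral_lintegral_swap (by unfold Function.uncurry; fun_prop)]
    _ = (∫⁻ u, k u) * ∫⁻ r, g r ^ 2 * ∫⁻ u, k u := by
        congr 1
        refine lintegral_congr fun r => ?_
        rw [lintegral_const_mul _ (by fun_prop), lintegral_sub_left_eq_self k r]
    _ = (∫⁻ u, k u) ^ 2 * ∫⁻ r, g r ^ 2 := by
        rw [lintegral_mul_const _ (by fun_prop)]
        ring

theorem rpow_sq_sub_sq_le {a r s : ℝ} (ha : a ≤ 0) (hs : 0 < s) (hr : s < r) :
    (r ^ 2 - s ^ 2) ^ a ≤ s ^ a * (r - s) ^ a := by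
  rw [← Real.mul_rpow hs.le (sub_pos.2 hr).le]
  exact Real.rpow_le_rpow_of_nonpos (mul_pos hs (sub_pos.2 hr)) (by nlinarith) ha

theorem lintegral_Ioc_rpow_lt_top {a : ℝ} (ha : -1 < a) (t : ℝ) :
    ∫⁻ u in Set.Ioc (0 : ℝ) t, ENNReal.ofReal (u ^ a) < ⊤ := by
  rcases le_total t 0 with ht | ht
  · simp [Set.Ioc_eq_empty (not_lt.2 ht)]
  · exact ((intervalIntegrable_iff_integrableOn_Ioc_of_le ht).1
      (intervalIntegral.intervalIntegrable_rpow' ha)).lintegral_lt_top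

theorem L2_subset_Lambda (H : ℝ) (hH : H ∈ Set.Ioo (1 / 2 : ℝ) 1)
    (t : ℝ) (ht : 0 < t) (f : ℝ → ℝ) (hf : Measurable f)
    (hfL2 : ∫⁻ r in Set.Ioc (0 : ℝ) t, ENNReal.ofReal ((f r) ^ 2) < ⊤) :
    ∫⁻ s in Set.Ioc (0 : ℝ) t,
        ENNReal.ofReal (s ^ (3 - 2 * H)) *
          (∫⁻ r in Set.Ioc s t,
              ENNReal.ofReal (|f r| * (r ^ 2 - s ^ 2) ^ (H - 3 / 2))) ^ 2 < ⊤ := by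
  obtain ⟨hH0, hH1⟩ := hH
  set a := H - 3 / 2 with ha
  set g : ℝ → ℝ≥0∞ := (Set.Ioc 0 t).indicator fun r => ENNReal.ofReal |f r| with hg
  set k : ℝ → ℝ≥0∞ := (Set.Ioc 0 t).indicator fun u => ENNReal.ofReal (u ^ a) with hk
  have hgm : Measurable g := Measurable.indicator (by fun_prop) measurableSet_Ioc
  have hkm : Measurable k := Measurable.indicator (by fun_prop) measurableSet_Ioc
  have hkfin : ∫⁻ u, k u < ⊤ := by
    rw [hk, lintegral_indicator measurableSet_Ioc]
    exact lintegral_Ioc_rpow_lt_top (by linarith) t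
  have hgfin : ∫⁻ r, g r ^ 2 < ⊤ := by
    convert hfL2 using 1
    rw [← lintegral_indicator measurableSet_Ioc]
    refine lintegral_congr fun r => ?_
    by_cases hr : r ∈ Set.Ioc 0 t
    · simp only [hg, Set.indicator_of_mem hr]
      rw [← ENNReal.ofReal_pow (abs_nonneg _), sq_abs]
    · simp [hg, Set.indicator_of_notMem hr]
  have hinner : ∀ s ∈ Set.Ioc 0 t,
      ∫⁻ r in Set.Ioc s t, ENNReal.ofReal (|f r| * (r ^ 2 - s ^ 2) ^ a) ≤
        ENNReal.ofReal (s ^ a) * ∫⁻ r, g r * k (r - s) := fun s hs => by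
    rw [← lintegral_const_mul _ (by fun_prop)]
    refine (setLIntegral_mono (by fun_prop) fun r hr => ?_).trans (setLIntegral_le_lintegral _ _)
    have hr0 : r ∈ Set.Ioc 0 t := ⟨hs.1.trans hr.1, hr.2⟩
    have hrs : r - s ∈ Set.Ioc 0 t := ⟨sub_pos.2 hr.1, by linarith [hs.1, hr.2]⟩
    simp only [hg, hk, Set.indicator_of_mem hr0, Set.indicator_of_mem hrs]
    rw [← ENNReal.ofReal_mul (abs_nonneg _),
      ← ENNReal.ofReal_mul (Real.rpow_nonneg hs.1.le _), mul_left_comm]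
    exact ENNReal.ofReal_le_ofReal (mul_le_mul_of_nonneg_left
      (rpow_sq_sub_sq_le (by linarith) hs.1 hr.1) (abs_nonneg _))
  have hweight : ∀ s, 0 < s →
      ENNReal.ofReal (s ^ (3 - 2 * H)) * ENNReal.ofReal (s ^ a) ^ 2 = 1 := fun s hs => by
    rw [← ENNReal.ofReal_pow (Real.rpow_nonneg hs.le _),
      ← ENNReal.ofReal_mul (Real.rpow_nonneg hs.le _), ← Real.rpow_mul_natCast hs.le,
      ← Real.rpow_add hs]
    have : 3 - 2 * H + a * (2 : ℕ) = 0 := by rw [ha]; push_cast; ring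
    rw [this, Real.rpow_zero, ENNReal.ofReal_one]
  calc _ ≤ ∫⁻ s in Set.Ioc 0 t, (∫⁻ r, g r * k (r - s)) ^ 2 := by
        refine setLIntegral_mono' measurableSet_Ioc fun s hs => ?_
        calc _ ≤ ENNReal.ofReal (s ^ (3 - 2 * H)) *
              (ENNReal.ofReal (s ^ a) * ∫⁻ r, g r * k (r - s)) ^ 2 := by
              gcongr
              exact hinner s hs
          _ = _ := by rw [mul_pow, ← mul_assoc, hweight s hs.1, one_mul]
    _ ≤ ∫⁻ s, (∫⁻ r, g r * k (r - s)) ^ 2 := setLIntegral_le_lintegral _ _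
    _ ≤ (∫⁻ u, k u) ^ 2 * ∫⁻ r, g r ^ 2 := lintegral_sq_lintegral_mul_sub_le hgm hkm
    _ < ⊤ := ENNReal.mul_lt_top (ENNReal.pow_lt_top hkfin) hgfin
end

section
/- Let ϑ > 0 and H ∈ (1/2,1). Then lim_{T→∞} (1/T) ∫₀^T ∫₀^t e^{−ϑ(t−s)} (t+s)^{2H−2} ds dt = 0. Equivalently, lim_{T→∞} (1/T) ∫₀^T e^{−2ϑt} ∫_t^{2t} e^{ϑu} u^{2H−2} du dt = 0. -/
open Real MeasureTheory Filter

/-- The shifted form of the kernel integral, by the substitution `u = t + s`. -/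
lemma exp_mul_integral_shift (ϑ a t : ℝ) :
    Real.exp (-2 * ϑ * t) * ∫ u in t..(2 * t), Real.exp (ϑ * u) * u ^ a =
      ∫ s in (0 : ℝ)..t, Real.exp (-ϑ * (t - s)) * (t + s) ^ a := by
  have h := intervalIntegral.integral_comp_add_left (a := 0) (b := t)
    (fun u : ℝ => Real.exp (ϑ * u) * u ^ a) t
  rw [add_zero, ← two_mul] at h
  rw [← h, ← intervalIntegral.integral_const_mul]
  congr 1
  ext s
  rw [← mul_assoc, ← Real.exp_add]
  ring_nf

lemma integral_exp_neg_mul_sub_le {ϑ : ℝ} (hϑ : 0 < ϑ) (t : ℝ) :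
    ∫ s in (0 : ℝ)..t, Real.exp (-ϑ * (t - s)) ≤ 1 / ϑ := by
  have h : ∀ s ∈ Set.uIcc 0 t, HasDerivAt (fun s : ℝ => Real.exp (-ϑ * (t - s)) / ϑ)
      (Real.exp (-ϑ * (t - s))) s := by
    intro s _
    have h1 : HasDerivAt (fun s : ℝ => -ϑ * (t - s)) ϑ s := by
      simpa using ((hasDerivAt_id s).const_sub t).const_mul (-ϑ)
    simpa [hϑ.ne'] using h1.exp.div_const ϑ
  rw [intervalIntegral.integral_eq_sub_of_hasDerivAt h
    (Continuous.intervalIntegrable (by fun_prop) _ _)]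
  have : 0 ≤ Real.exp (-ϑ * (t - 0)) / ϑ := by positivity
  simpa using this

lemma norm_integral_exp_mul_rpow_le {ϑ a t : ℝ} (hϑ : 0 < ϑ) (ha : a ≤ 0) (ht : 0 < t) :
    ‖∫ s in (0 : ℝ)..t, Real.exp (-ϑ * (t - s)) * (t + s) ^ a‖ ≤ 1 / ϑ * t ^ a := by
  calc ‖∫ s in (0 : ℝ)..t, Real.exp (-ϑ * (t - s)) * (t + s) ^ a‖
      ≤ ∫ s in (0 : ℝ)..t, Real.exp (-ϑ * (t - s)) * t ^ a := by
        refine intervalIntegral.norm_integral_le_of_norm_le ht.le (ae_of_all _ fun s hs => ?_)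
          (Continuous.intervalIntegrable (by fun_prop) _ _)
        have hts : 0 < t + s := add_pos ht hs.1
        rw [Real.norm_of_nonneg (by positivity)]
        gcongr ?_ * ?_
        exact Real.rpow_le_rpow_of_nonpos ht (by linarith [hs.1]) ha
    _ ≤ 1 / ϑ * t ^ a := by
        rw [intervalIntegral.integral_mul_const]
        gcongr
        exact integral_exp_neg_mul_sub_le hϑ t

/-- The time average of a function dominated by a negative power of `t` tends to zero. -/
lemma tendsto_average_of_norm_le_rpow {g : ℝ → ℝ} {C a : ℝ} (ha : -1 < a) (ha' : a < 0)
    (hg : ∀ t, 0 < t → ‖g t‖ ≤ C * t ^ a) :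
    Tendsto (fun T : ℝ => (1 / T) * ∫ t in (0 : ℝ)..T, g t) atTop (nhds 0) := by
  have hlim : Tendsto (fun T : ℝ => C / (a + 1) * T ^ a) atTop (nhds 0) := by
    simpa using (tendsto_rpow_neg_atTop (neg_pos.2 ha')).const_mul (C / (a + 1))
  refine squeeze_zero_norm' ?_ hlim
  filter_upwards [eventually_gt_atTop 0] with T hT
  have h : ‖∫ t in (0 : ℝ)..T, g t‖ ≤ ∫ t in (0 : ℝ)..T, C * t ^ a :=
    intervalIntegral.norm_integral_le_of_norm_le hT.le (ae_of_all _ fun t ht => hg t ht.1)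
      ((intervalIntegral.intervalIntegrable_rpow' ha).const_mul C)
  have ha1 : a + 1 ≠ 0 := by linarith
  rw [intervalIntegral.integral_const_mul, integral_rpow (Or.inl ha), Real.zero_rpow ha1,
    sub_zero, Real.rpow_add_one hT.ne'] at h
  rw [norm_mul, Real.norm_of_nonneg (by positivity : 0 ≤ 1 / T)]
  calc 1 / T * ‖∫ t in (0 : ℝ)..T, g t‖
      ≤ 1 / T * (C * (T ^ a * T / (a + 1))) := by gcongr
    _ = C / (a + 1) * T ^ a := by field_simp

theorem nonstationary_kernel_vanishes (ϑ H : ℝ) (hϑ : 0 < ϑ)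
    (hH : H ∈ Set.Ioo (1 / 2 : ℝ) 1) :
    Tendsto (fun T : ℝ =>
        (1 / T) * ∫ t in (0 : ℝ)..T, ∫ s in (0 : ℝ)..t,
          Real.exp (-ϑ * (t - s)) * (t + s) ^ (2 * H - 2))
      atTop (nhds 0) ∧
    Tendsto (fun T : ℝ =>
        (1 / T) * ∫ t in (0 : ℝ)..T,
          Real.exp (-2 * ϑ * t) * ∫ u in t..(2 * t), Real.exp (ϑ * u) * u ^ (2 * H - 2))
      atTop (nhds 0) := by
  obtain ⟨h1, h2⟩ := hH
  simp only [exp_mul_integral_shift, and_self]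
  exact tendsto_average_of_norm_le_rpow (by linarith) (by linarith) fun t ht =>
    norm_integral_exp_mul_rpow_le hϑ (by linarith) ht
end

section
/- Let ϑ > 0 and H ∈ (1/2,3/4). Then lim_{T→∞} (1/T) ∫_{[0,T]⁴} e^{−ϑ|u₂−s₂| − ϑ|u₁−s₁|} (u₂+u₁)^{2H−2} (s₂+s₁)^{2H−2} ds₁ ds₂ du₁ du₂ = 0. -/
open Real MeasureTheory Filter

/-- A negative power of a sum of positive numbers is at most the product of the half powers. -/
theorem add_rpow_le_mul_rpow_half {a x y : ℝ} (ha : a ≤ 0) (hx : 0 < x) (hy : 0 < y) :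
    (x + y) ^ a ≤ x ^ (a / 2) * y ^ (a / 2) := by
  have hxy : 0 < x + y := add_pos hx hy
  rw [← add_halves a, rpow_add hxy, add_halves]
  exact mul_le_mul (rpow_le_rpow_of_nonpos hx (by linarith) (by linarith))
    (rpow_le_rpow_of_nonpos hy (by linarith) (by linarith)) (by positivity) (by positivity)

theorem rpow_half_mul_rpow_half_le {a x y : ℝ} (hx : 0 < x) (hy : 0 < y) :
    x ^ (a / 2) * y ^ (a / 2) ≤ x ^ a + y ^ a := by
  have h1 : x ^ a = x ^ (a / 2) * x ^ (a / 2) := by rw [← rpow_add hx, add_halves]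
  have h2 : y ^ a = y ^ (a / 2) * y ^ (a / 2) := by rw [← rpow_add hy, add_halves]
  rw [h1, h2]
  nlinarith [sq_nonneg (x ^ (a / 2) - y ^ (a / 2)), mul_self_nonneg (x ^ (a / 2)),
    mul_self_nonneg (y ^ (a / 2))]

theorem add_rpow_mul_add_rpow_le {a u₁ u₂ s₁ s₂ : ℝ} (ha : a ≤ 0) (hu₁ : 0 < u₁) (hu₂ : 0 < u₂)
    (hs₁ : 0 < s₁) (hs₂ : 0 < s₂) :
    (u₂ + u₁) ^ a * (s₂ + s₁) ^ a ≤ (u₂ ^ a + s₂ ^ a) * (u₁ ^ a + s₁ ^ a) :=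
  calc (u₂ + u₁) ^ a * (s₂ + s₁) ^ a
      ≤ (u₂ ^ (a / 2) * u₁ ^ (a / 2)) * (s₂ ^ (a / 2) * s₁ ^ (a / 2)) :=
        mul_le_mul (add_rpow_le_mul_rpow_half ha hu₂ hu₁) (add_rpow_le_mul_rpow_half ha hs₂ hs₁)
          (by positivity) (by positivity)
    _ = (u₂ ^ (a / 2) * s₂ ^ (a / 2)) * (u₁ ^ (a / 2) * s₁ ^ (a / 2)) := by ring
    _ ≤ _ := mul_le_mul (rpow_half_mul_rpow_half_le hu₂ hs₂) (rpow_half_mul_rpow_half_le hu₁ hs₁)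
          (by positivity) (by positivity)

theorem lintegral_exp_neg_mul_abs_ne_top {c : ℝ} (hc : 0 < c) :
    ∫⁻ x : ℝ, ENNReal.ofReal (exp (-c * |x|)) ≠ ⊤ := by
  have hneg : IntegrableOn (fun x : ℝ => exp (-c * |x|)) (Set.Iic 0) :=
    (integrableOn_exp_mul_Iic hc 0).congr_fun
      (fun x hx => by simp [abs_of_nonpos (Set.mem_Iic.1 hx)]) measurableSet_Iic
  have hpos : IntegrableOn (fun x : ℝ => exp (-c * |x|)) (Set.Ioi 0) :=
    (integrableOn_exp_mul_Ioi (neg_lt_zero.2 hc) 0).congr_fun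
      (fun x hx => by simp [abs_of_pos (Set.mem_Ioi.1 hx)]) measurableSet_Ioi
  have h := hneg.union hpos
  rw [Set.Iic_union_Ioi, integrableOn_univ] at h
  exact h.lintegral_lt_top.ne

theorem setLIntegral_Ioc_ofReal_rpow {a T : ℝ} (ha : -1 < a) (hT : 0 ≤ T) :
    ∫⁻ x in Set.Ioc 0 T, ENNReal.ofReal (x ^ a) = ENNReal.ofReal (T ^ (a + 1) / (a + 1)) := by
  have h := intervalIntegral.intervalIntegrable_rpow' (a := 0) (b := T) ha
  rw [intervalIntegrable_iff_integrableOn_Ioc_of_le hT] at h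
  rw [← ofReal_integral_eq_lintegral_ofReal h, ← intervalIntegral.integral_of_le hT,
    integral_rpow (Or.inl ha), zero_rpow (by linarith), sub_zero]
  filter_upwards [ae_restrict_mem measurableSet_Ioc] with x hx
  exact rpow_nonneg hx.1.le a

/-- The convolution of a weight with an integrable even kernel, integrated in both variables. -/
theorem lintegral_lintegral_kernel_mul_add_le {μ : Measure ℝ} [SFinite μ] (hμ : μ ≤ volume)
    {k q : ℝ → ENNReal} (hk : Measurable k) (hq : Measurable q) (hk_even : ∀ x, k (-x) = k x) :
    ∫⁻ u, ∫⁻ s, k (u - s) * (q u + q s) ∂μ ∂μ ≤ 2 * ((∫⁻ x, k x) * ∫⁻ x, q x ∂μ) := by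
  have hsub : ∀ u s, k (u - s) = k (s - u) := fun u s => by rw [← hk_even, neg_sub]
  have hkernel : ∀ u, ∫⁻ s, k (s - u) ∂μ ≤ ∫⁻ x, k x := fun u =>
    (lintegral_mono' hμ le_rfl).trans (lintegral_sub_right_eq_self k u).le
  have hfst : ∫⁻ u, ∫⁻ s, k (s - u) * q u ∂μ ∂μ ≤ (∫⁻ x, k x) * ∫⁻ x, q x ∂μ := by
    rw [← lintegral_const_mul _ hq]
    refine lintegral_mono fun u => ?_
    rw [lintegral_mul_const _ (by fun_prop)]
    exact mul_le_mul_left (hkernel u) _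
  have hsnd : ∫⁻ u, ∫⁻ s, k (u - s) * q s ∂μ ∂μ ≤ (∫⁻ x, k x) * ∫⁻ x, q x ∂μ := by
    rw [lintegral_lintegral_swap (by fun_prop)]
    exact hfst
  calc ∫⁻ u, ∫⁻ s, k (u - s) * (q u + q s) ∂μ ∂μ
      = ∫⁻ u, (∫⁻ s, k (s - u) * q u ∂μ) + ∫⁻ s, k (u - s) * q s ∂μ ∂μ := by
        refine lintegral_congr fun u => ?_
        rw [← lintegral_add_left (by fun_prop)]
        refine lintegral_congr fun s => ?_
        rw [mul_add, hsub u s]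
    _ = (∫⁻ u, ∫⁻ s, k (s - u) * q u ∂μ ∂μ) + ∫⁻ u, ∫⁻ s, k (u - s) * q s ∂μ ∂μ :=
        lintegral_add_left (Measurable.lintegral_prod_right'
          (f := fun z : ℝ × ℝ => k (z.2 - z.1) * q z.1) (by fun_prop)) _
    _ ≤ _ := by rw [two_mul]; exact add_le_add hfst hsnd

theorem lintegral_four_mul_eq_sq {μ : Measure ℝ} [SFinite μ] {g : ℝ → ℝ → ENNReal}
    (hg : Measurable (Function.uncurry g)) :
    ∫⁻ u₂, ∫⁻ u₁, ∫⁻ s₂, ∫⁻ s₁, g u₂ s₂ * g u₁ s₁ ∂μ ∂μ ∂μ ∂μ =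
      (∫⁻ u, ∫⁻ s, g u s ∂μ ∂μ) ^ 2 := by
  have hgu : ∀ u, Measurable (g u) := fun u => hg.comp measurable_prodMk_left
  have hG : Measurable fun u => ∫⁻ s, g u s ∂μ := hg.lintegral_prod_right'
  simp_rw [lintegral_const_mul _ (hgu _), lintegral_mul_const _ (hgu _), lintegral_const_mul _ hG,
    lintegral_mul_const _ hG, sq]

theorem enorm_intervalIntegral_le_setLIntegral {f : ℝ → ℝ} {g : ℝ → ENNReal} {T : ℝ} (hT : 0 ≤ T)
    (hfg : ∀ x ∈ Set.Ioc 0 T, ‖f x‖ₑ ≤ g x) :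
    ‖∫ x in (0 : ℝ)..T, f x‖ₑ ≤ ∫⁻ x in Set.Ioc 0 T, g x := by
  rw [intervalIntegral.integral_of_le hT]
  exact (enorm_integral_le_lintegral_enorm _).trans (setLIntegral_mono' measurableSet_Ioc hfg)

theorem enorm_cross_term_le {c a T : ℝ} (ha : -1 < a) (ha' : a ≤ 0) (hT : 0 ≤ T) :
    ‖∫ u₂ in (0 : ℝ)..T, ∫ u₁ in (0 : ℝ)..T, ∫ s₂ in (0 : ℝ)..T, ∫ s₁ in (0 : ℝ)..T,
      exp (-c * |u₂ - s₂| - c * |u₁ - s₁|) * (u₂ + u₁) ^ a * (s₂ + s₁) ^ a‖ₑ ≤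
    (2 * ((∫⁻ x : ℝ, ENNReal.ofReal (exp (-c * |x|))) *
      ENNReal.ofReal (T ^ (a + 1) / (a + 1)))) ^ 2 := by
  have hk : Measurable fun x : ℝ => ENNReal.ofReal (exp (-c * |x|)) := by fun_prop
  have hq : Measurable fun x : ℝ => ENNReal.ofReal (x ^ a) := by fun_prop
  have hkernel := lintegral_lintegral_kernel_mul_add_le
    (Measure.restrict_le_self (μ := volume) (s := Set.Ioc 0 T)) hk hq (fun x => by rw [abs_neg])
  rw [setLIntegral_Ioc_ofReal_rpow ha hT] at hkernel
  refine le_trans ?_ (pow_le_pow_left' hkernel 2)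
  rw [← lintegral_four_mul_eq_sq (by unfold Function.uncurry; fun_prop)]
  refine enorm_intervalIntegral_le_setLIntegral hT fun u₂ hu₂ => ?_
  refine enorm_intervalIntegral_le_setLIntegral hT fun u₁ hu₁ => ?_
  refine enorm_intervalIntegral_le_setLIntegral hT fun s₂ hs₂ => ?_
  refine enorm_intervalIntegral_le_setLIntegral hT fun s₁ hs₁ => ?_
  have hu₁ := hu₁.1
  have hu₂ := hu₂.1
  have hs₁ := hs₁.1
  have hs₂ := hs₂.1
  rw [Real.enorm_of_nonneg (by positivity),
    ← ENNReal.ofReal_add (by positivity) (by positivity),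
    ← ENNReal.ofReal_add (by positivity) (by positivity),
    ← ENNReal.ofReal_mul (by positivity), ← ENNReal.ofReal_mul (by positivity),
    ← ENNReal.ofReal_mul (by positivity)]
  refine ENNReal.ofReal_le_ofReal ?_
  calc exp (-c * |u₂ - s₂| - c * |u₁ - s₁|) * (u₂ + u₁) ^ a * (s₂ + s₁) ^ a
      = exp (-c * |u₂ - s₂|) * exp (-c * |u₁ - s₁|) * ((u₂ + u₁) ^ a * (s₂ + s₁) ^ a) := by
        rw [← exp_add, mul_assoc]
        ring_nf
    _ ≤ exp (-c * |u₂ - s₂|) * exp (-c * |u₁ - s₁|) *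
          ((u₂ ^ a + s₂ ^ a) * (u₁ ^ a + s₁ ^ a)) :=
        mul_le_mul_of_nonneg_left (add_rpow_mul_add_rpow_le ha' hu₁ hu₂ hs₁ hs₂) (by positivity)
    _ = _ := by ring

theorem cross_term_vanishes_both_plus (ϑ H : ℝ) (hϑ : 0 < ϑ)
    (hH : H ∈ Set.Ioo (1 / 2 : ℝ) (3 / 4)) :
    Tendsto (fun T : ℝ =>
        (1 / T) * ∫ u₂ in (0 : ℝ)..T, ∫ u₁ in (0 : ℝ)..T, ∫ s₂ in (0 : ℝ)..T,
          ∫ s₁ in (0 : ℝ)..T,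
            Real.exp (-ϑ * |u₂ - s₂| - ϑ * |u₁ - s₁|) *
              (u₂ + u₁) ^ (2 * H - 2) * (s₂ + s₁) ^ (2 * H - 2))
      atTop (nhds 0) := by
  obtain ⟨hH₁, hH₂⟩ := hH
  generalize ha : 2 * H - 2 = a
  have ha₁ : -1 < a := by linarith
  have ha₂ : a < -1 / 2 := by linarith
  set K : ℝ := (∫⁻ x : ℝ, ENNReal.ofReal (exp (-ϑ * |x|))).toReal with hK
  have hdecay : Tendsto (fun T : ℝ => (2 * K / (a + 1)) ^ 2 * T ^ (-(-(2 * a + 1)))) atTop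
      (nhds 0) := by
    simpa using (tendsto_rpow_neg_atTop (by linarith : 0 < -(2 * a + 1))).const_mul
      ((2 * K / (a + 1)) ^ 2)
  refine squeeze_zero_norm' ?_ hdecay
  filter_upwards [eventually_gt_atTop 0] with T hT
  have hpos : 0 < a + 1 := by linarith
  have hbound := ENNReal.toReal_mono (by
    have := lintegral_exp_neg_mul_abs_ne_top hϑ
    finiteness) (enorm_cross_term_le (c := ϑ) ha₁ (by linarith) hT.le)
  rw [toReal_enorm, ENNReal.toReal_pow, ENNReal.toReal_mul, ENNReal.toReal_mul, ← hK,
    ENNReal.toReal_ofReal (by positivity), ENNReal.toReal_ofNat] at hbound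
  rw [norm_mul, Real.norm_of_nonneg (by positivity : 0 ≤ 1 / T)]
  refine (mul_le_mul_of_nonneg_left hbound (by positivity)).trans_eq ?_
  have hpow : T ^ (2 * a + 1) * T = T ^ (a + 1) * T ^ (a + 1) := by
    rw [← rpow_add_one hT.ne', ← rpow_add hT]
    ring_nf
  rw [neg_neg]
  field_simp
  linear_combination -K ^ 2 * hpow
end

section
/- Let ϑ > 0 and H ∈ (1/2,3/4). Then lim_{T→∞} (H²(2H−1)²/(2T)) ∫_{[0,T]⁴} e^{−ϑ|u₂−s₂| − ϑ|u₁−s₁|} |u₂−u₁|^{2H−2} |s₂−s₁|^{2H−2} ds₁ ds₂ du₁ du₂ = ϑ^{1−4H} H² (4H−1) (Γ(2H)² + Γ(2H)Γ(3−4H)Γ(4H−1)/Γ(2−2H)). -/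
open Real MeasureTheory Filter

theorem lintegral_eq_Ioi_add_Ioi_neg (f : ℝ → ENNReal) :
    ∫⁻ x, f x = (∫⁻ x in Set.Ioi 0, f x) + ∫⁻ x in Set.Ioi 0, f (-x) := by
  have hneg : ∫⁻ x in Set.Ioi (0 : ℝ), f (-x) = ∫⁻ x in Set.Iio (0 : ℝ), f x := by
    have h := (Measure.measurePreserving_neg (volume : Measure ℝ)).setLIntegral_comp_preimage_emb
      (Homeomorph.neg ℝ).measurableEmbedding f (Set.Iio 0)
    simpa using h
  rw [hneg, ← lintegral_add_compl f (measurableSet_Ioi (a := (0 : ℝ))), Set.compl_Ioi,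
    setLIntegral_congr Iio_ae_eq_Iic]

theorem lintegral_comp_mul_left_real {c : ℝ} (hc : c ≠ 0) (f : ℝ → ENNReal) :
    ∫⁻ x, f x = ENNReal.ofReal |c| * ∫⁻ x, f (c * x) := by
  have h := (Homeomorph.mulLeft₀ c hc).measurableEmbedding.lintegral_map f (μ := volume)
  have h2 := Real.smul_map_volume_mul_left hc
  simp only [Homeomorph.coe_mulLeft₀] at h
  rw [← h, ← smul_eq_mul, ← lintegral_smul_measure, h2]

theorem lintegral_rpow_mul_exp_neg_mul {p s : ℝ} (hp : 0 < p) (hs : 0 < s) :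
    ∫⁻ t in Set.Ioi 0, ENNReal.ofReal (t ^ (p - 1) * Real.exp (-(s * t))) =
      ENNReal.ofReal ((1 / s) ^ p * Real.Gamma p) := by
  have h := Real.integral_rpow_mul_exp_neg_mul_Ioi hp hs
  rw [← h, ofReal_integral_eq_lintegral_ofReal]
  · by_contra hn
    rw [integral_undef hn] at h
    have : 0 < (1 / s) ^ p * Real.Gamma p := by
      have := Real.Gamma_pos_of_pos hp
      positivity
    linarith
  · filter_upwards [ae_restrict_mem measurableSet_Ioi] with t ht
    have : (0 : ℝ) < t := ht
    positivity

theorem lintegral_rpow_mul_one_add_rpow {a c : ℝ} (ha : 0 < a) (hac : a < c) :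
    ∫⁻ t in Set.Ioi 0, ENNReal.ofReal (t ^ (a - 1) * (1 + t) ^ (-c)) =
      ENNReal.ofReal (Real.Gamma a * Real.Gamma (c - a) / Real.Gamma c) := by
  have hc : 0 < c := ha.trans hac
  have hΓc := Real.Gamma_pos_of_pos hc
  have hΓa := Real.Gamma_pos_of_pos ha
  have hswap : ∫⁻ t in Set.Ioi (0 : ℝ), ∫⁻ s in Set.Ioi (0 : ℝ),
        ENNReal.ofReal (t ^ (a - 1) * (s ^ (c - 1) * Real.exp (-((1 + t) * s)))) =
      ∫⁻ s in Set.Ioi (0 : ℝ), ∫⁻ t in Set.Ioi (0 : ℝ),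
        ENNReal.ofReal (t ^ (a - 1) * (s ^ (c - 1) * Real.exp (-((1 + t) * s)))) :=
    lintegral_lintegral_swap (by fun_prop)
  have hleft : ∫⁻ t in Set.Ioi (0 : ℝ), ∫⁻ s in Set.Ioi (0 : ℝ),
        ENNReal.ofReal (t ^ (a - 1) * (s ^ (c - 1) * Real.exp (-((1 + t) * s)))) =
      (∫⁻ t in Set.Ioi 0, ENNReal.ofReal (t ^ (a - 1) * (1 + t) ^ (-c))) *
        ENNReal.ofReal (Real.Gamma c) := by
    rw [← lintegral_mul_const _ (by fun_prop)]
    refine setLIntegral_congr_fun measurableSet_Ioi fun t (ht : 0 < t) => ?_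
    have ht1 : 0 < 1 + t := by linarith
    simp_rw [ENNReal.ofReal_mul (Real.rpow_nonneg ht.le (a - 1))]
    rw [lintegral_const_mul _ (by fun_prop), lintegral_rpow_mul_exp_neg_mul hc ht1,
      ← ENNReal.ofReal_mul (by positivity), mul_assoc,
      ← ENNReal.ofReal_mul (by positivity), one_div, Real.inv_rpow ht1.le, Real.rpow_neg ht1.le,
      ENNReal.ofReal_mul (by positivity)]
  have hright : ∫⁻ s in Set.Ioi (0 : ℝ), ∫⁻ t in Set.Ioi (0 : ℝ),
        ENNReal.ofReal (t ^ (a - 1) * (s ^ (c - 1) * Real.exp (-((1 + t) * s)))) =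
      ENNReal.ofReal (Real.Gamma a * Real.Gamma (c - a)) := by
    have hinner : ∀ s ∈ Set.Ioi (0 : ℝ), (∫⁻ t in Set.Ioi (0 : ℝ),
          ENNReal.ofReal (t ^ (a - 1) * (s ^ (c - 1) * Real.exp (-((1 + t) * s))))) =
        ENNReal.ofReal (Real.Gamma a) *
          ENNReal.ofReal (s ^ (c - a - 1) * Real.exp (-(1 * s))) := by
      intro s (hs : 0 < s)
      have : ∀ t : ℝ, t ^ (a - 1) * (s ^ (c - 1) * Real.exp (-((1 + t) * s))) =
          (s ^ (c - 1) * Real.exp (-(1 * s))) * (t ^ (a - 1) * Real.exp (-(s * t))) := by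
        intro t
        rw [show -((1 + t) * s) = -(1 * s) + -(s * t) by ring, Real.exp_add]
        ring
      simp_rw [this]
      simp_rw [ENNReal.ofReal_mul (p := s ^ (c - 1) * Real.exp (-(1 * s))) (by positivity)]
      rw [lintegral_const_mul _ (by fun_prop), lintegral_rpow_mul_exp_neg_mul ha hs,
        ← ENNReal.ofReal_mul (by positivity), ← ENNReal.ofReal_mul (by positivity)]
      congr 1
      rw [one_div, Real.inv_rpow hs.le, ← Real.rpow_neg hs.le,
        show c - a - 1 = (c - 1) + (-a) by ring, Real.rpow_add hs]
      ring
    rw [setLIntegral_congr_fun measurableSet_Ioi hinner, lintegral_const_mul _ (by fun_prop),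
      lintegral_rpow_mul_exp_neg_mul (by linarith) one_pos,
      ← ENNReal.ofReal_mul (by positivity)]
    simp
  rw [hleft, hright] at hswap
  rw [ENNReal.ofReal_div_of_pos hΓc, ← hswap, ENNReal.mul_div_cancel_right]
  · simpa using hΓc
  · simp

theorem lintegral_rpow_mul_one_sub_rpow {a b : ℝ} (ha : 0 < a) (hb : 0 < b) :
    ∫⁻ t in Set.Ioo (0 : ℝ) 1, ENNReal.ofReal (t ^ (a - 1) * (1 - t) ^ (b - 1)) =
      ENNReal.ofReal (Real.Gamma a * Real.Gamma b / Real.Gamma (a + b)) := by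
  have hβ := ProbabilityTheory.beta_pos ha hb
  have h := ProbabilityTheory.lintegral_betaPDF_eq_one ha hb
  rw [ProbabilityTheory.lintegral_betaPDF] at h
  simp_rw [mul_assoc,
    ENNReal.ofReal_mul (p := 1 / ProbabilityTheory.beta a b) (one_div_pos.2 hβ).le] at h
  rw [lintegral_const_mul _ (by fun_prop)] at h
  change _ = ENNReal.ofReal (ProbabilityTheory.beta a b)
  rw [one_div, ENNReal.ofReal_inv_of_pos hβ] at h
  exact (ENNReal.eq_inv_of_mul_eq_one_left ((mul_comm _ _).trans h)).trans (inv_inv _)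

/-- The self-convolution of the Riesz kernel `|x| ^ (a - 1)` at the unit point. -/
theorem lintegral_abs_rpow_mul_abs_one_sub_rpow {a : ℝ} (ha : 0 < a) (ha2 : a < 1 / 2) :
    ∫⁻ q : ℝ, ENNReal.ofReal (|q| ^ (a - 1) * |1 - q| ^ (a - 1)) =
      ENNReal.ofReal (Real.Gamma a ^ 2 / Real.Gamma (2 * a) +
        2 * (Real.Gamma a * Real.Gamma (1 - 2 * a) / Real.Gamma (1 - a))) := by
  have h1 := Real.Gamma_pos_of_pos ha
  have h2 := Real.Gamma_pos_of_pos (show 0 < 2 * a by linarith)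
  have h3 := Real.Gamma_pos_of_pos (show 0 < 1 - 2 * a by linarith)
  have h4 := Real.Gamma_pos_of_pos (show 0 < 1 - a by linarith)
  have hB := lintegral_rpow_mul_one_add_rpow (a := a) (c := 1 - a) ha (by linarith)
  rw [show 1 - a - a = 1 - 2 * a by ring, show -(1 - a) = a - 1 by ring] at hB
  have hneg : ∫⁻ q in Set.Ioi (0 : ℝ), ENNReal.ofReal (|-q| ^ (a - 1) * |1 - -q| ^ (a - 1)) =
      ∫⁻ t in Set.Ioi 0, ENNReal.ofReal (t ^ (a - 1) * (1 + t) ^ (a - 1)) := by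
    refine setLIntegral_congr_fun measurableSet_Ioi fun t (ht : 0 < t) => ?_
    simp only [abs_neg, sub_neg_eq_add]
    rw [abs_of_pos ht, abs_of_pos (show 0 < 1 + t by linarith)]
  have hunit : ∫⁻ q in Set.Ioo (0 : ℝ) 1, ENNReal.ofReal (|q| ^ (a - 1) * |1 - q| ^ (a - 1)) =
      ENNReal.ofReal (Real.Gamma a ^ 2 / Real.Gamma (2 * a)) := by
    rw [sq, two_mul, ← lintegral_rpow_mul_one_sub_rpow ha ha]
    refine setLIntegral_congr_fun measurableSet_Ioo fun t ht => ?_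
    rw [abs_of_pos ht.1, abs_of_pos (sub_pos.2 ht.2)]
  have hbig : ∫⁻ q in Set.Ioi (1 : ℝ), ENNReal.ofReal (|q| ^ (a - 1) * |1 - q| ^ (a - 1)) =
      ∫⁻ t in Set.Ioi 0, ENNReal.ofReal (t ^ (a - 1) * (1 + t) ^ (a - 1)) := by
    have h := (measurePreserving_add_right (volume : Measure ℝ) 1).setLIntegral_comp_preimage_emb
      (Homeomorph.addRight (1 : ℝ)).measurableEmbedding
      (fun q => ENNReal.ofReal (|q| ^ (a - 1) * |1 - q| ^ (a - 1))) (Set.Ioi 1)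
    rw [← h]
    simp only [Set.preimage_add_const_Ioi, sub_self]
    refine setLIntegral_congr_fun measurableSet_Ioi fun t (ht : 0 < t) => ?_
    rw [abs_of_pos (show 0 < t + 1 by linarith), show 1 - (t + 1) = -t by ring, abs_neg,
      abs_of_pos ht, mul_comm, add_comm t]
  rw [lintegral_eq_Ioi_add_Ioi_neg, hneg, ← Set.Ioc_union_Ioi_eq_Ioi (zero_le_one' ℝ),
    lintegral_union measurableSet_Ioi (Set.Ioc_disjoint_Ioi le_rfl),
    ← setLIntegral_congr Ioo_ae_eq_Ioc, hunit, hbig]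
  rw [Set.Ioc_union_Ioi_eq_Ioi (zero_le_one' ℝ), hB, add_assoc, ← two_mul,
    ENNReal.ofReal_add (by positivity) (by positivity), ENNReal.ofReal_mul zero_le_two]
  simp

theorem lintegral_abs_rpow_mul_abs_sub_rpow {a x : ℝ} (ha : 0 < a) (ha2 : a < 1 / 2)
    (hx : x ≠ 0) :
    ∫⁻ q : ℝ, ENNReal.ofReal (|q| ^ (a - 1) * |x - q| ^ (a - 1)) =
      ENNReal.ofReal (|x| ^ (2 * a - 1)) *
        ENNReal.ofReal (Real.Gamma a ^ 2 / Real.Gamma (2 * a) +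
          2 * (Real.Gamma a * Real.Gamma (1 - 2 * a) / Real.Gamma (1 - a))) := by
  have hx' : 0 < |x| := abs_pos.2 hx
  rw [lintegral_comp_mul_left_real hx, ← lintegral_abs_rpow_mul_abs_one_sub_rpow ha ha2]
  have : ∀ q : ℝ, |x * q| ^ (a - 1) * |x - x * q| ^ (a - 1) =
      (|x| ^ (a - 1) * |x| ^ (a - 1)) * (|q| ^ (a - 1) * |1 - q| ^ (a - 1)) := by
    intro q
    rw [show x - x * q = x * (1 - q) by ring, abs_mul, abs_mul,
      Real.mul_rpow (abs_nonneg _) (abs_nonneg _), Real.mul_rpow (abs_nonneg _) (abs_nonneg _)]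
    ring
  simp_rw [this]
  simp_rw [ENNReal.ofReal_mul (p := |x| ^ (a - 1) * |x| ^ (a - 1)) (by positivity)]
  rw [lintegral_const_mul _ (by fun_prop), ← mul_assoc, ← ENNReal.ofReal_mul (abs_nonneg _)]
  congr 2
  rw [show 2 * a - 1 = 1 + (a - 1) + (a - 1) by ring, Real.rpow_add hx', Real.rpow_add hx',
    Real.rpow_one, mul_assoc]

theorem lintegral_exp_neg_mul_Ioi {c : ℝ} (hc : 0 < c) (x : ℝ) :
    ∫⁻ y in Set.Ioi x, ENNReal.ofReal (Real.exp (-c * y)) =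
      ENNReal.ofReal (Real.exp (-c * x) / c) := by
  rw [← ofReal_integral_eq_lintegral_ofReal (integrableOn_exp_mul_Ioi (neg_lt_zero.2 hc) x)
    (ae_of_all _ fun _ => (Real.exp_pos _).le), integral_exp_mul_Ioi (neg_lt_zero.2 hc),
    neg_div_neg_eq]

theorem lintegral_exp_neg_abs_mul_exp_neg_abs_sub {ϑ x : ℝ} (hϑ : 0 < ϑ) (hx : 0 ≤ x) :
    ∫⁻ y : ℝ, ENNReal.ofReal (Real.exp (-ϑ * |y|) * Real.exp (-ϑ * |x - y|)) =
      ENNReal.ofReal (Real.exp (-ϑ * x) * (1 / ϑ + x)) := by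
  have hneg : ∫⁻ y in Set.Ioi (0 : ℝ),
        ENNReal.ofReal (Real.exp (-ϑ * |-y|) * Real.exp (-ϑ * |x - -y|)) =
      ENNReal.ofReal (Real.exp (-ϑ * x) / (2 * ϑ)) := by
    have h : ∀ y ∈ Set.Ioi (0 : ℝ),
        ENNReal.ofReal (Real.exp (-ϑ * |-y|) * Real.exp (-ϑ * |x - -y|)) =
          ENNReal.ofReal (Real.exp (-ϑ * x)) * ENNReal.ofReal (Real.exp (-(2 * ϑ) * y)) := by
      intro y (hy : 0 < y)
      rw [abs_neg, abs_of_pos hy, sub_neg_eq_add, abs_of_pos (by linarith), ← Real.exp_add,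
        ← ENNReal.ofReal_mul (Real.exp_pos _).le, ← Real.exp_add]
      congr 2
      ring
    rw [setLIntegral_congr_fun measurableSet_Ioi h, lintegral_const_mul _ (by fun_prop),
      lintegral_exp_neg_mul_Ioi (by positivity), ← ENNReal.ofReal_mul (Real.exp_pos _).le]
    simp [div_eq_mul_inv]
  have hmid : ∫⁻ y in Set.Ioc (0 : ℝ) x,
        ENNReal.ofReal (Real.exp (-ϑ * |y|) * Real.exp (-ϑ * |x - y|)) =
      ENNReal.ofReal (Real.exp (-ϑ * x) * x) := by
    have h : ∀ y ∈ Set.Ioc (0 : ℝ) x,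
        ENNReal.ofReal (Real.exp (-ϑ * |y|) * Real.exp (-ϑ * |x - y|)) =
          ENNReal.ofReal (Real.exp (-ϑ * x)) := by
      intro y hy
      rw [abs_of_pos hy.1, abs_of_nonneg (sub_nonneg.2 hy.2), ← Real.exp_add]
      congr 2
      ring
    rw [setLIntegral_congr_fun measurableSet_Ioc h, setLIntegral_const, Real.volume_Ioc, sub_zero,
      ENNReal.ofReal_mul (Real.exp_pos _).le]
  have hbig : ∫⁻ y in Set.Ioi x,
        ENNReal.ofReal (Real.exp (-ϑ * |y|) * Real.exp (-ϑ * |x - y|)) =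
      ENNReal.ofReal (Real.exp (-ϑ * x) / (2 * ϑ)) := by
    have h : ∀ y ∈ Set.Ioi x,
        ENNReal.ofReal (Real.exp (-ϑ * |y|) * Real.exp (-ϑ * |x - y|)) =
          ENNReal.ofReal (Real.exp (ϑ * x)) * ENNReal.ofReal (Real.exp (-(2 * ϑ) * y)) := by
      intro y (hy : x < y)
      rw [abs_of_pos (hx.trans_lt hy), abs_of_neg (sub_neg.2 hy), ← Real.exp_add,
        ← ENNReal.ofReal_mul (Real.exp_pos _).le, ← Real.exp_add]
      congr 2
      ring
    rw [setLIntegral_congr_fun measurableSet_Ioi h, lintegral_const_mul _ (by fun_prop),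
      lintegral_exp_neg_mul_Ioi (by positivity), ← ENNReal.ofReal_mul (Real.exp_pos _).le,
      mul_div_assoc', ← Real.exp_add]
    congr 3
    ring
  rw [lintegral_eq_Ioi_add_Ioi_neg, hneg, ← Set.Ioc_union_Ioi_eq_Ioi hx,
    lintegral_union measurableSet_Ioi (Set.Ioc_disjoint_Ioi le_rfl), hmid, hbig,
    ← ENNReal.ofReal_add (by positivity) (by positivity),
    ← ENNReal.ofReal_add (by positivity) (by positivity)]
  congr 1
  field_simp
  ring

/-- The integrand of the asymptotic variance, seen from the variable `u₂ = 0`, as a function of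
`(u₁, s₂, s₁)`. -/
noncomputable def cycleKernel (ϑ a : ℝ) (p : ℝ × ℝ × ℝ) : ℝ :=
  Real.exp (-ϑ * |p.2.1|) * Real.exp (-ϑ * |p.1 - p.2.2|) *
    (|p.1| ^ (a - 1) * |p.2.2 - p.2.1| ^ (a - 1))

/-- The total mass of `cycleKernel`. -/
noncomputable def cycleMass (ϑ a : ℝ) : ℝ :=
  2 * ((1 / ϑ) ^ (2 * a + 1) * ((1 + 2 * a) * Real.Gamma (2 * a))) *
    (Real.Gamma a ^ 2 / Real.Gamma (2 * a) +
      2 * (Real.Gamma a * Real.Gamma (1 - 2 * a) / Real.Gamma (1 - a)))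

theorem cycleKernel_nonneg (ϑ a : ℝ) (p : ℝ × ℝ × ℝ) : 0 ≤ cycleKernel ϑ a p := by
  unfold cycleKernel
  positivity

@[fun_prop]
theorem measurable_cycleKernel (ϑ a : ℝ) : Measurable (cycleKernel ϑ a) := by
  unfold cycleKernel
  fun_prop

theorem lintegral_exp_neg_abs_mul_exp_neg_abs_sub' {ϑ : ℝ} (hϑ : 0 < ϑ) (x : ℝ) :
    ∫⁻ y : ℝ, ENNReal.ofReal (Real.exp (-ϑ * |y|) * Real.exp (-ϑ * |x - y|)) =
      ENNReal.ofReal (Real.exp (-ϑ * |x|) * (1 / ϑ + |x|)) := by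
  rw [← lintegral_exp_neg_abs_mul_exp_neg_abs_sub hϑ (abs_nonneg x)]
  rcases abs_choice x with h | h
  · rw [h]
  · rw [h, ← lintegral_sub_left_eq_self _ (0 : ℝ)]
    refine lintegral_congr fun y => ?_
    rw [zero_sub, abs_neg, show x - -y = -(-x - y) by ring, abs_neg]

theorem lintegral_exp_mul_abs_rpow {ϑ a : ℝ} (hϑ : 0 < ϑ) (ha : 0 < a) :
    ∫⁻ x : ℝ, ENNReal.ofReal (Real.exp (-ϑ * |x|) * (1 / ϑ + |x|) * |x| ^ (2 * a - 1)) =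
      ENNReal.ofReal (2 * ((1 / ϑ) ^ (2 * a + 1) * ((1 + 2 * a) * Real.Gamma (2 * a)))) := by
  have hΓ := Real.Gamma_pos_of_pos (show 0 < 2 * a by linarith)
  have h : ∫⁻ x in Set.Ioi (0 : ℝ),
        ENNReal.ofReal (Real.exp (-ϑ * |x|) * (1 / ϑ + |x|) * |x| ^ (2 * a - 1)) =
      ENNReal.ofReal ((1 / ϑ) ^ (2 * a + 1) * ((1 + 2 * a) * Real.Gamma (2 * a))) := by
    have h1 : ∀ x ∈ Set.Ioi (0 : ℝ),
        ENNReal.ofReal (Real.exp (-ϑ * |x|) * (1 / ϑ + |x|) * |x| ^ (2 * a - 1)) =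
          ENNReal.ofReal (1 / ϑ) * ENNReal.ofReal (x ^ (2 * a - 1) * Real.exp (-(ϑ * x))) +
            ENNReal.ofReal (x ^ (2 * a + 1 - 1) * Real.exp (-(ϑ * x))) := by
      intro x (hx : 0 < x)
      rw [← ENNReal.ofReal_mul (by positivity),
        ← ENNReal.ofReal_add (by positivity) (by positivity), abs_of_pos hx,
        show 2 * a + 1 - 1 = 1 + (2 * a - 1) by ring, Real.rpow_add hx, Real.rpow_one]
      congr 1
      ring_nf
    rw [setLIntegral_congr_fun measurableSet_Ioi h1, lintegral_add_left (by fun_prop),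
      lintegral_const_mul _ (by fun_prop), lintegral_rpow_mul_exp_neg_mul (by linarith) hϑ,
      lintegral_rpow_mul_exp_neg_mul (by linarith) hϑ, ← ENNReal.ofReal_mul (by positivity),
      Real.Gamma_add_one (by positivity), ← ENNReal.ofReal_add (by positivity) (by positivity),
      Real.rpow_add (by positivity), Real.rpow_one]
    congr 1
    ring
  rw [lintegral_eq_Ioi_add_Ioi_neg]
  simp only [abs_neg]
  rw [h, ← two_mul, ENNReal.ofReal_mul zero_le_two]
  simp

theorem lintegral_cycleKernel {ϑ a : ℝ} (hϑ : 0 < ϑ) (ha : 0 < a) (ha2 : a < 1 / 2) :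
    ∫⁻ p, ENNReal.ofReal (cycleKernel ϑ a p) = ENNReal.ofReal (cycleMass ϑ a) := by
  have hΓ := Real.Gamma_pos_of_pos (show 0 < 2 * a by linarith)
  have hinner : ∀ u : ℝ, ∫⁻ q : ℝ × ℝ, ENNReal.ofReal (cycleKernel ϑ a (u, q)) =
      ∫⁻ x : ℝ, ENNReal.ofReal (|u| ^ (a - 1) * |x - u| ^ (a - 1)) *
        ENNReal.ofReal (Real.exp (-ϑ * |x|) * (1 / ϑ + |x|)) := by
    intro u
    have hshift : ∀ s : ℝ, ∫⁻ s' : ℝ, ENNReal.ofReal (cycleKernel ϑ a (u, s, s')) =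
        ∫⁻ x : ℝ, ENNReal.ofReal (|u| ^ (a - 1) * |x - u| ^ (a - 1)) *
          ENNReal.ofReal (Real.exp (-ϑ * |s|) * Real.exp (-ϑ * |x - s|)) := by
      intro s
      rw [← lintegral_sub_left_eq_self _ (s + u)]
      refine lintegral_congr fun x => ?_
      rw [cycleKernel, ← ENNReal.ofReal_mul (by positivity), show u - (s + u - x) = x - s by ring,
        show s + u - x - s = -(x - u) by ring, abs_neg]
      congr 1
      ring
    rw [Measure.volume_eq_prod, lintegral_prod _ (by fun_prop)]
    simp_rw [hshift]
    rw [lintegral_lintegral_swap (by fun_prop)]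
    refine lintegral_congr fun x => ?_
    rw [lintegral_const_mul _ (by fun_prop), lintegral_exp_neg_abs_mul_exp_neg_abs_sub' hϑ]
  rw [Measure.volume_eq_prod, lintegral_prod _ (by fun_prop)]
  simp_rw [hinner]
  rw [lintegral_lintegral_swap (by fun_prop), cycleMass, ENNReal.ofReal_mul (by positivity),
    ← lintegral_exp_mul_abs_rpow hϑ ha, ← lintegral_mul_const _ (by fun_prop)]
  refine lintegral_congr_ae ?_
  filter_upwards [compl_mem_ae_iff.2 (measure_singleton (0 : ℝ))] with x hx
  rw [lintegral_mul_const _ (by fun_prop), lintegral_abs_rpow_mul_abs_sub_rpow ha ha2 hx,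
    ENNReal.ofReal_mul (p := Real.exp (-ϑ * |x|) * (1 / ϑ + |x|)) (by positivity)]
  ring

theorem cycleMass_nonneg {ϑ a : ℝ} (hϑ : 0 < ϑ) (ha : 0 < a) (ha2 : a < 1 / 2) :
    0 ≤ cycleMass ϑ a := by
  have h1 := Real.Gamma_pos_of_pos ha
  have h2 := Real.Gamma_pos_of_pos (show 0 < 2 * a by linarith)
  have h3 := Real.Gamma_pos_of_pos (show 0 < 1 - 2 * a by linarith)
  have h4 := Real.Gamma_pos_of_pos (show 0 < 1 - a by linarith)
  unfold cycleMass
  positivity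

theorem integrable_cycleKernel {ϑ a : ℝ} (hϑ : 0 < ϑ) (ha : 0 < a) (ha2 : a < 1 / 2) :
    Integrable (cycleKernel ϑ a) := by
  refine ⟨by fun_prop, ?_⟩
  rw [hasFiniteIntegral_iff_ofReal (ae_of_all _ (cycleKernel_nonneg ϑ a)),
    lintegral_cycleKernel hϑ ha ha2]
  exact ENNReal.ofReal_lt_top

theorem integral_cycleKernel {ϑ a : ℝ} (hϑ : 0 < ϑ) (ha : 0 < a) (ha2 : a < 1 / 2) :
    ∫ p, cycleKernel ϑ a p = cycleMass ϑ a := by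
  rw [integral_eq_lintegral_of_nonneg_ae (ae_of_all _ (cycleKernel_nonneg ϑ a)) (by fun_prop),
    lintegral_cycleKernel hϑ ha ha2, ENNReal.toReal_ofReal (cycleMass_nonneg hϑ ha ha2)]

/-- The cube `(A, B]³`. -/
def cube (A B : ℝ) : Set (ℝ × ℝ × ℝ) :=
  Set.Ioc A B ×ˢ (Set.Ioc A B ×ˢ Set.Ioc A B)

theorem measurableSet_cube (A B : ℝ) : MeasurableSet (cube A B) :=
  measurableSet_Ioc.prod (measurableSet_Ioc.prod measurableSet_Ioc)

theorem integral_cube {G : ℝ × ℝ × ℝ → ℝ} (hG : Integrable G) {A B : ℝ} (hAB : A ≤ B) :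
    ∫ x in A..B, ∫ y in A..B, ∫ z in A..B, G (x, y, z) = ∫ p in cube A B, G p := by
  have hG' : Integrable G ((volume.restrict (Set.Ioc A B)).prod
      ((volume.restrict (Set.Ioc A B)).prod (volume.restrict (Set.Ioc A B)))) := by
    rw [Measure.prod_restrict, Measure.prod_restrict]
    exact hG.restrict
  rw [cube, Measure.volume_eq_prod, Measure.volume_eq_prod, ← Measure.prod_restrict,
    ← Measure.prod_restrict, integral_prod _ hG']
  simp_rw [intervalIntegral.integral_of_le hAB]
  refine integral_congr_ae ?_
  filter_upwards [hG'.prod_right_ae] with x hx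
  exact (integral_prod _ hx).symm

theorem tendsto_setIntegral_cube {G : ℝ × ℝ × ℝ → ℝ} (hG : Integrable G) {A B : ℝ → ℝ}
    (hA : Tendsto A atTop atBot) (hB : Tendsto B atTop atTop) :
    Tendsto (fun T => ∫ p in cube (A T) (B T), G p) atTop (nhds (∫ p, G p)) := by
  simp_rw [← integral_indicator (measurableSet_cube _ _)]
  refine tendsto_integral_filter_of_dominated_convergence (fun p => ‖G p‖)
    (.of_forall fun T => hG.aestronglyMeasurable.indicator (measurableSet_cube _ _))
    (.of_forall fun T => ae_of_all _ fun p => norm_indicator_le_norm_self _ _) hG.norm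
    (ae_of_all _ fun p => tendsto_const_nhds.congr' ?_)
  filter_upwards [hA.eventually_lt_atBot p.1, hA.eventually_lt_atBot p.2.1,
    hA.eventually_lt_atBot p.2.2, hB.eventually_ge_atTop p.1, hB.eventually_ge_atTop p.2.1,
    hB.eventually_ge_atTop p.2.2] with T h1 h2 h3 h4 h5 h6
  rw [Set.indicator_of_mem]
  exact ⟨⟨h1, h4⟩, ⟨h2, h5⟩, ⟨h3, h6⟩⟩

theorem measurable_setIntegral_cube {G : ℝ × ℝ × ℝ → ℝ} (hG : Measurable G) {A B : ℝ → ℝ}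
    (hA : Measurable A) (hB : Measurable B) :
    Measurable fun v => ∫ p in cube (A v) (B v), G p := by
  simp_rw [← integral_indicator (measurableSet_cube _ _)]
  have hS : MeasurableSet {q : ℝ × ℝ × ℝ × ℝ | q.2 ∈ cube (A q.1) (B q.1)} := by
    simp only [cube, Set.mem_prod, Set.mem_Ioc]
    measurability
  exact ((hG.comp measurable_snd).indicator hS).stronglyMeasurable.integral_prod_right'.measurable

theorem tendsto_average_setIntegral_cube {G : ℝ × ℝ × ℝ → ℝ} (hG : Measurable G)
    (hGi : Integrable G) :
    Tendsto (fun T : ℝ => T⁻¹ * ∫ u in (0 : ℝ)..T, ∫ p in cube (0 - u) (T - u), G p) atTop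
      (nhds (∫ p, G p)) := by
  have hscale : (fun T : ℝ => ∫ v in (0 : ℝ)..1, ∫ p in cube (0 - T * v) (T - T * v), G p)
      =ᶠ[atTop] fun T : ℝ => T⁻¹ * ∫ u in (0 : ℝ)..T, ∫ p in cube (0 - u) (T - u), G p := by
    filter_upwards [eventually_gt_atTop 0] with T hT
    rw [intervalIntegral.integral_comp_mul_left
      (fun u => ∫ p in cube (0 - u) (T - u), G p) hT.ne']
    simp
  refine Tendsto.congr' hscale ?_
  have hconst : ∫ p, G p = ∫ _ in (0 : ℝ)..1, ∫ p, G p := by simp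
  rw [hconst]
  refine intervalIntegral.tendsto_integral_filter_of_dominated_convergence
    (fun _ => ∫ p, ‖G p‖)
    (.of_forall fun T => (measurable_setIntegral_cube hG
      (by fun_prop) (by fun_prop)).aestronglyMeasurable)
    (.of_forall fun T => ae_of_all _ fun v _ => ?_) (by simp) ?_
  · exact (norm_integral_le_integral_norm _).trans
      (setIntegral_le_integral hGi.norm (ae_of_all _ fun p => norm_nonneg _))
  · filter_upwards [compl_mem_ae_iff.2 (measure_singleton (1 : ℝ))] with v hv1 hv
    rw [Set.uIoc_of_le zero_le_one] at hv
    have hv' : 0 < 1 - v := sub_pos.2 (lt_of_le_of_ne hv.2 hv1)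
    refine tendsto_setIntegral_cube hGi ?_ ?_
    · simp_rw [zero_sub]
      exact tendsto_neg_atTop_atBot.comp (tendsto_id.atTop_mul_const hv.1)
    · exact (tendsto_id.atTop_mul_const hv').congr fun T => by simp only [id]; ring

theorem integral_shift_cycleKernel {ϑ a : ℝ} (hϑ : 0 < ϑ) (ha : 0 < a) (ha2 : a < 1 / 2)
    {T : ℝ} (hT : 0 ≤ T) (u₂ : ℝ) :
    ∫ u₁ in (0 : ℝ)..T, ∫ s₂ in (0 : ℝ)..T, ∫ s₁ in (0 : ℝ)..T,
        Real.exp (-ϑ * |u₂ - s₂| - ϑ * |u₁ - s₁|) *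
          |u₂ - u₁| ^ (a - 1) * |s₂ - s₁| ^ (a - 1) =
      ∫ p in cube (0 - u₂) (T - u₂), cycleKernel ϑ a p := by
  rw [← integral_cube (integrable_cycleKernel hϑ ha ha2) (by linarith),
    ← intervalIntegral.integral_comp_sub_right]
  congr 1 with u₁
  rw [← intervalIntegral.integral_comp_sub_right]
  congr 1 with s₂
  rw [← intervalIntegral.integral_comp_sub_right
    (fun s₁ => cycleKernel ϑ a (u₁ - u₂, s₂ - u₂, s₁))]
  congr 1 with s₁
  simp only [cycleKernel]
  rw [show u₁ - u₂ - (s₁ - u₂) = u₁ - s₁ by ring, show s₁ - u₂ - (s₂ - u₂) = s₁ - s₂ by ring,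
    abs_sub_comm s₂ u₂, abs_sub_comm u₁ u₂, abs_sub_comm s₁ s₂, ← Real.exp_add, mul_assoc]
  congr 2
  ring

theorem half_mul_cycleMass {ϑ H : ℝ} (hϑ : 0 < ϑ) (hH : 1 / 2 < H) :
    H ^ 2 * (2 * H - 1) ^ 2 / 2 * cycleMass ϑ (2 * H - 1) =
      ϑ ^ (1 - 4 * H) * H ^ 2 * (4 * H - 1) *
        (Real.Gamma (2 * H) ^ 2 +
          Real.Gamma (2 * H) * Real.Gamma (3 - 4 * H) * Real.Gamma (4 * H - 1)
            / Real.Gamma (2 - 2 * H)) := by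
  have h1 : Real.Gamma (2 * H) = (2 * H - 1) * Real.Gamma (2 * H - 1) := by
    rw [← Real.Gamma_add_one (by linarith)]
    ring_nf
  have h2 : Real.Gamma (4 * H - 1) = (2 * (2 * H - 1)) * Real.Gamma (2 * (2 * H - 1)) := by
    rw [← Real.Gamma_add_one (by linarith)]
    ring_nf
  have hpow : (1 / ϑ) ^ (2 * (2 * H - 1) + 1) = ϑ ^ (1 - 4 * H) := by
    rw [one_div, Real.inv_rpow hϑ.le, ← Real.rpow_neg hϑ.le]
    ring_nf
  have hΓ := (Real.Gamma_pos_of_pos (show 0 < 2 * (2 * H - 1) by linarith)).ne'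
  rw [cycleMass, hpow, h1, h2, show 1 - 2 * (2 * H - 1) = 3 - 4 * H by ring,
    show 1 - (2 * H - 1) = 2 - 2 * H by ring]
  generalize Real.Gamma (2 * (2 * H - 1)) = g at hΓ ⊢
  simp only [div_eq_mul_inv]
  generalize (Real.Gamma (2 - 2 * H))⁻¹ = w
  field_simp
  ring

theorem asymptotic_variance_main_term (ϑ H : ℝ) (hϑ : 0 < ϑ)
    (hH : H ∈ Set.Ioo (1 / 2 : ℝ) (3 / 4)) :
    Tendsto (fun T : ℝ =>
        (H ^ 2 * (2 * H - 1) ^ 2 / (2 * T)) *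
          ∫ u₂ in (0 : ℝ)..T, ∫ u₁ in (0 : ℝ)..T, ∫ s₂ in (0 : ℝ)..T,
            ∫ s₁ in (0 : ℝ)..T,
              Real.exp (-ϑ * |u₂ - s₂| - ϑ * |u₁ - s₁|) *
                |u₂ - u₁| ^ (2 * H - 2) * |s₂ - s₁| ^ (2 * H - 2))
      atTop (nhds (ϑ ^ (1 - 4 * H) * H ^ 2 * (4 * H - 1) *
        (Real.Gamma (2 * H) ^ 2 +
          Real.Gamma (2 * H) * Real.Gamma (3 - 4 * H) * Real.Gamma (4 * H - 1)
            / Real.Gamma (2 - 2 * H)))) := by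
  obtain ⟨hH1, hH2⟩ := hH
  have ha : 0 < 2 * H - 1 := by linarith
  have ha2 : 2 * H - 1 < 1 / 2 := by linarith
  rw [← half_mul_cycleMass hϑ hH1, ← integral_cycleKernel hϑ ha ha2]
  refine Tendsto.congr' ?_ ((tendsto_average_setIntegral_cube (measurable_cycleKernel ϑ _)
    (integrable_cycleKernel hϑ ha ha2)).const_mul _)
  filter_upwards [eventually_gt_atTop 0] with T hT
  rw [show 2 * H - 2 = 2 * H - 1 - 1 by ring]
  simp_rw [integral_shift_cycleKernel hϑ ha ha2 hT.le]
  ring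
end

section
/- Let ϑ > 0 and H ∈ (1/2,1). There exists a constant C = C(ϑ,H) > 0 such that for all 0 ≤ s < t ≤ T (for every T ≥ t), ∫_t^T ∫_s^T e^{−ϑ(ξ−s)} e^{−ϑ(η−t)} H(2H−1)(|ξ−η|^{2H−2} − (ξ+η)^{2H−2}) dξ dη ≤ C (t−s)^{2H−2}. -/
open Real MeasureTheory

lemma integral_indicator_abs_rpow {a r : ℝ} (ha : -1 < a) (hr : 0 < r) :
    ∫ x : ℝ, (Set.Iic r).indicator (fun x : ℝ ↦ x ^ a) |x| = 2 * (r ^ (a + 1) / (a + 1)) := by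
  rw [integral_comp_abs, setIntegral_indicator measurableSet_Iic, Set.Ioi_inter_Iic,
    ← intervalIntegral.integral_of_le hr.le, integral_rpow (Or.inl ha),
    zero_rpow (by linarith), sub_zero]

lemma integrableOn_exp_neg_mul_sub_Ioi {θ : ℝ} (hθ : 0 < θ) (s : ℝ) :
    IntegrableOn (fun x ↦ exp (-θ * (x - s))) (Set.Ioi s) := by
  have h := (integrableOn_exp_mul_Ioi (neg_neg_of_pos hθ) s).mul_const (exp (θ * s))
  refine h.congr (.of_forall fun x ↦ ?_)
  simp only [← exp_add]
  ring_nf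

lemma integral_exp_neg_mul_sub_Ioi {θ : ℝ} (hθ : 0 < θ) (s : ℝ) :
    ∫ x in Set.Ioi s, exp (-θ * (x - s)) = 1 / θ := by
  have h : ∀ x, exp (-θ * (x - s)) = exp (-θ * x) * exp (θ * s) := fun x ↦ by
    rw [← exp_add]; ring_nf
  simp_rw [h]
  rw [integral_mul_const, integral_exp_mul_Ioi (neg_neg_of_pos hθ), neg_div_neg_eq,
    div_mul_eq_mul_div, ← exp_add]
  simp

/-- The exponentially weighted singular kernel `|ξ - η| ^ a` is integrable on `(s, ∞)`, and its
integral decays like `(η - s) ^ a`. -/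
lemma integral_exp_mul_abs_rpow_le {a θ s η : ℝ} (ha : -1 < a) (ha' : a ≤ 0) (hθ : 0 < θ)
    (hs : s < η) :
    IntegrableOn (fun ξ ↦ exp (-θ * (ξ - s)) * |ξ - η| ^ a) (Set.Ioi s) ∧
      ∫ ξ in Set.Ioi s, exp (-θ * (ξ - s)) * |ξ - η| ^ a
        ≤ 1 / θ * (1 + 2 / (a + 1)) * ((η - s) / 2) ^ a := by
  set r := (η - s) / 2 with hr_def
  have hr : 0 < r := by rw [hr_def]; linarith
  have ha1 : 0 < a + 1 := by linarith
  set ψ : ℝ → ℝ := fun x ↦ (Set.Iic r).indicator (fun x : ℝ ↦ x ^ a) |x| with hψ_def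
  have hψ : Integrable ψ := .of_integral_ne_zero <| by
    rw [integral_indicator_abs_rpow ha hr]
    positivity
  have hψ0 : ∀ x, 0 ≤ ψ x := fun x ↦
    Set.indicator_apply_nonneg fun _ ↦ rpow_nonneg (abs_nonneg x) a
  have hψη : Integrable fun ξ ↦ ψ (ξ - η) := hψ.comp_sub_right η
  have hexp := integrableOn_exp_neg_mul_sub_Ioi hθ s
  have hg : IntegrableOn (fun ξ ↦ exp (-θ * (ξ - s)) * r ^ a + exp (-θ * r) * ψ (ξ - η))
      (Set.Ioi s) := (hexp.mul_const _).add (hψη.integrableOn.const_mul _)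
  have hle : ∀ ξ, exp (-θ * (ξ - s)) * |ξ - η| ^ a
      ≤ exp (-θ * (ξ - s)) * r ^ a + exp (-θ * r) * ψ (ξ - η) := by
    intro ξ
    by_cases h : |ξ - η| ≤ r
    · have h1 : ψ (ξ - η) = |ξ - η| ^ a := Set.indicator_of_mem (s := Set.Iic r) h _
      have h2 : r ≤ ξ - s := by linarith [(abs_le.1 h).1]
      have h3 : exp (-θ * (ξ - s)) ≤ exp (-θ * r) := exp_le_exp.2 (by nlinarith)
      rw [h1]
      have h4 : 0 ≤ |ξ - η| ^ a := rpow_nonneg (abs_nonneg _) a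
      have h5 := mul_le_mul_of_nonneg_right h3 h4
      have h6 : 0 ≤ exp (-θ * (ξ - s)) * r ^ a := by positivity
      linarith
    · have h1 : |ξ - η| ^ a ≤ r ^ a := rpow_le_rpow_of_nonpos hr (not_le.1 h).le ha'
      have h2 := mul_le_mul_of_nonneg_left h1 (exp_pos (-θ * (ξ - s))).le
      have h3 := mul_nonneg (exp_pos (-θ * r)).le (hψ0 (ξ - η))
      linarith
  have h0 : ∀ ξ, 0 ≤ exp (-θ * (ξ - s)) * |ξ - η| ^ a := fun ξ ↦ by positivity
  have hint : IntegrableOn (fun ξ ↦ exp (-θ * (ξ - s)) * |ξ - η| ^ a) (Set.Ioi s) := by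
    refine hg.mono' (Measurable.aestronglyMeasurable (by fun_prop)) (.of_forall fun ξ ↦ ?_)
    rw [norm_of_nonneg (h0 ξ)]
    exact hle ξ
  refine ⟨hint, (integral_mono hint hg hle).trans ?_⟩
  rw [integral_add (hexp.mul_const _) (hψη.integrableOn.const_mul _), integral_mul_const,
    integral_const_mul, integral_exp_neg_mul_sub_Ioi hθ]
  have hψle : ∫ ξ in Set.Ioi s, ψ (ξ - η) ≤ 2 * (r ^ (a + 1) / (a + 1)) := by
    refine (setIntegral_le_integral hψη (.of_forall fun ξ ↦ hψ0 _)).trans_eq ?_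
    rw [integral_sub_right_eq_self ψ η]
    exact integral_indicator_abs_rpow ha hr
  have hdecay : exp (-θ * r) * r ≤ 1 / θ := by
    rw [le_div_iff₀ hθ, neg_mul, exp_neg, mul_assoc, inv_mul_le_iff₀ (exp_pos _)]
    linarith [add_one_le_exp (θ * r)]
  calc 1 / θ * r ^ a + exp (-θ * r) * ∫ ξ in Set.Ioi s, ψ (ξ - η)
      ≤ 1 / θ * r ^ a + exp (-θ * r) * (2 * (r ^ (a + 1) / (a + 1))) := by gcongr
    _ = 1 / θ * r ^ a + exp (-θ * r) * r * (2 / (a + 1) * r ^ a) := by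
      rw [rpow_add_one hr.ne']; ring
    _ ≤ 1 / θ * r ^ a + 1 / θ * (2 / (a + 1) * r ^ a) := by gcongr
    _ = 1 / θ * (1 + 2 / (a + 1)) * r ^ a := by ring

theorem wiener_integral_cov_bound_forward (ϑ H : ℝ) (hϑ : 0 < ϑ)
    (hH : H ∈ Set.Ioo (1 / 2 : ℝ) 1) :
    ∃ C : ℝ, 0 < C ∧ ∀ T s t : ℝ, 0 ≤ s → s < t → t ≤ T →
      (∫ η in t..T, ∫ ξ in s..T,
          Real.exp (-ϑ * (ξ - s)) * Real.exp (-ϑ * (η - t)) *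
            (H * (2 * H - 1) * (|ξ - η| ^ (2 * H - 2) - (ξ + η) ^ (2 * H - 2))))
        ≤ C * (t - s) ^ (2 * H - 2) := by
  obtain ⟨hH1, hH2⟩ := hH
  set a := 2 * H - 2 with ha_def
  have ha : -1 < a := by linarith
  have ha' : a ≤ 0 := by linarith
  have ha1 : 0 < a + 1 := by linarith
  set c := H * (2 * H - 1) with hc_def
  have hc : 0 < c := mul_pos (by linarith) (by linarith)
  set M := 1 / ϑ * (1 + 2 / (a + 1)) with hM_def
  have hM : 0 < M := by positivity
  refine ⟨c * M * (1 / 2) ^ a * (1 / ϑ), by positivity, fun T s t hs hst htT ↦ ?_⟩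
  have hd : 0 < t - s := sub_pos.2 hst
  have hnonneg : ∀ η, t < η → ∀ᵐ ξ ∂volume.restrict (Set.Ioc s T),
      0 ≤ exp (-ϑ * (ξ - s)) * exp (-ϑ * (η - t)) * (c * (|ξ - η| ^ a - (ξ + η) ^ a)) := by
    intro η hη
    filter_upwards [ae_restrict_mem measurableSet_Ioc,
      ae_restrict_of_ae (Measure.ae_ne volume η)] with ξ hξ hne
    have h1 : (ξ + η) ^ a ≤ |ξ - η| ^ a :=
      rpow_le_rpow_of_nonpos (abs_pos.2 (sub_ne_zero.2 hne))
        (abs_le.2 ⟨by linarith [hξ.1], by linarith⟩) ha'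
    have h2 : 0 ≤ |ξ - η| ^ a - (ξ + η) ^ a := sub_nonneg.2 h1
    positivity
  have hinner : ∀ η, t < η →
      ∫ ξ in Set.Ioc s T, exp (-ϑ * (ξ - s)) * exp (-ϑ * (η - t)) *
        (c * (|ξ - η| ^ a - (ξ + η) ^ a))
      ≤ exp (-ϑ * (η - t)) * (c * M * (1 / 2) ^ a * (t - s) ^ a) := by
    intro η hη
    obtain ⟨hint, hle⟩ := integral_exp_mul_abs_rpow_le ha ha' hϑ (hst.trans hη)
    have hk : 0 ≤ exp (-ϑ * (η - t)) * c := by positivity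
    calc _ ≤ ∫ ξ in Set.Ioc s T,
          exp (-ϑ * (η - t)) * c * (exp (-ϑ * (ξ - s)) * |ξ - η| ^ a) := by
          refine integral_mono_of_nonneg (hnonneg η hη)
            ((hint.mono_set Set.Ioc_subset_Ioi_self).const_mul _) ?_
          filter_upwards [ae_restrict_mem measurableSet_Ioc] with ξ hξ
          have h1 : 0 ≤ (ξ + η) ^ a := rpow_nonneg (by linarith [hξ.1]) a
          have h2 : 0 ≤ exp (-ϑ * (ξ - s)) * exp (-ϑ * (η - t)) * c * (ξ + η) ^ a := by
            positivity
          linarith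
      _ = exp (-ϑ * (η - t)) * c * ∫ ξ in Set.Ioc s T, exp (-ϑ * (ξ - s)) * |ξ - η| ^ a :=
          integral_const_mul _ _
      _ ≤ exp (-ϑ * (η - t)) * c * ∫ ξ in Set.Ioi s, exp (-ϑ * (ξ - s)) * |ξ - η| ^ a := by
          refine mul_le_mul_of_nonneg_left (setIntegral_mono_set hint
            (.of_forall fun ξ ↦ ?_) (Set.Ioc_subset_Ioi_self).eventuallyLE) hk
          dsimp only [Pi.zero_apply]
          positivity
      _ ≤ exp (-ϑ * (η - t)) * c * (M * ((t - s) / 2) ^ a) := by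
          refine mul_le_mul_of_nonneg_left (hle.trans (mul_le_mul_of_nonneg_left ?_ hM.le)) hk
          exact rpow_le_rpow_of_nonpos (by linarith) (by linarith) ha'
      _ = _ := by
          rw [div_eq_mul_one_div, mul_rpow hd.le (by norm_num)]
          ring
  have hexp := integrableOn_exp_neg_mul_sub_Ioi hϑ t
  rw [intervalIntegral.integral_of_le htT]
  simp_rw [intervalIntegral.integral_of_le (hst.le.trans htT)]
  calc _ ≤ ∫ η in Set.Ioc t T, exp (-ϑ * (η - t)) * (c * M * (1 / 2) ^ a * (t - s) ^ a) := by
        refine integral_mono_of_nonneg ?_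
          ((hexp.mono_set Set.Ioc_subset_Ioi_self).mul_const _) ?_
        · filter_upwards [ae_restrict_mem measurableSet_Ioc] with η hη
          exact integral_nonneg_of_ae (hnonneg η hη.1)
        · filter_upwards [ae_restrict_mem measurableSet_Ioc] with η hη
          exact hinner η hη.1
    _ ≤ ∫ η in Set.Ioi t, exp (-ϑ * (η - t)) * (c * M * (1 / 2) ^ a * (t - s) ^ a) := by
        refine setIntegral_mono_set (hexp.mul_const _) (.of_forall fun η ↦ ?_)
          (Set.Ioc_subset_Ioi_self).eventuallyLE
        dsimp only [Pi.zero_apply]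
        positivity
    _ = _ := by
        rw [integral_mul_const, integral_exp_neg_mul_sub_Ioi hϑ]
        ring
end

section
/- Let ϑ > 0 and H ∈ (1/2,1). There exists a constant C = C(ϑ,H) > 0 such that for all 0 ≤ s < t, ∫₀^t ∫₀^s e^{−ϑ(t−u)} e^{−ϑ(s−v)} H(2H−1)(|u−v|^{2H−2} − (u+v)^{2H−2}) du dv ≤ C (t−s)^{2H−2}. -/
open Real MeasureTheory

lemma integral_indicator_Iio_abs_rpow {β r : ℝ} (hβ : -1 < β) (hr : 0 < r) :
    ∫ x : ℝ, (Set.Iio r).indicator (fun y => y ^ β) |x| = 2 * (r ^ (β + 1) / (β + 1)) := by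
  rw [integral_comp_abs (f := (Set.Iio r).indicator fun y => y ^ β),
    setIntegral_indicator measurableSet_Iio, Set.Ioi_inter_Iio, ← integral_Ioc_eq_integral_Ioo,
    ← intervalIntegral.integral_of_le hr.le, integral_rpow (Or.inl hβ),
    zero_rpow (by linarith), sub_zero]

lemma integrable_indicator_Iio_abs_rpow {β r : ℝ} (hβ : -1 < β) (hr : 0 < r) :
    Integrable fun x : ℝ => (Set.Iio r).indicator (fun y => y ^ β) |x| := by
  by_contra h
  have h0 := integral_indicator_Iio_abs_rpow hβ hr
  rw [integral_undef h] at h0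
  have h1 : 0 < r ^ (β + 1) := rpow_pos_of_pos hr _
  have h2 : 0 < r ^ (β + 1) / (β + 1) := div_pos h1 (by linarith)
  linarith

/-- Integrating the power `|u - v| ^ β` against an exponential weight that concentrates near `s`
costs at most a constant times the value of that power at `v = s`. -/
lemma integral_exp_mul_abs_rpow_le_s13 {ϑ β : ℝ} (hϑ : 0 < ϑ) (hβ : -1 < β) (hβ0 : β < 0)
    {s u : ℝ} (hu : u ≠ s) :
    IntegrableOn (fun v => exp (-ϑ * (s - v)) * |u - v| ^ β) (Set.Iic s) ∧
      ∫ v in Set.Iic s, exp (-ϑ * (s - v)) * |u - v| ^ β ≤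
        (1 / 2) ^ β * (1 / ϑ * (1 + 2 / (β + 1))) * |s - u| ^ β := by
  set r := |s - u| / 2 with hr_def
  have hr : 0 < r := half_pos (abs_pos.2 (sub_ne_zero.2 hu.symm))
  set g : ℝ → ℝ := fun x => (Set.Iio r).indicator (fun y => y ^ β) |x|
  have hg_int : Integrable fun v => g (u - v) :=
    (integrable_indicator_Iio_abs_rpow hβ hr).comp_sub_left u
  have hg_eq : ∫ v, g (u - v) = 2 * (r ^ (β + 1) / (β + 1)) := by
    rw [integral_sub_left_eq_self g]
    exact integral_indicator_Iio_abs_rpow hβ hr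
  have hg_nonneg : ∀ x, 0 ≤ g x := fun x =>
    Set.indicator_apply_nonneg fun _ => rpow_nonneg (abs_nonneg x) β
  have hexp : ∀ v, exp (-ϑ * (s - v)) = exp (-ϑ * s) * exp (ϑ * v) := fun v => by
    rw [← exp_add]; ring_nf
  have hE : IntegrableOn (fun v => exp (-ϑ * (s - v))) (Set.Iic s) := by
    simp_rw [hexp]
    exact (integrableOn_exp_mul_Iic hϑ s).const_mul _
  have hE_eq : ∫ v in Set.Iic s, exp (-ϑ * (s - v)) = 1 / ϑ := by
    simp_rw [hexp]
    rw [integral_const_mul, integral_exp_mul_Iic hϑ, ← mul_div_assoc, ← exp_add]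
    simp
  have hM : IntegrableOn (fun v => exp (-ϑ * (s - v)) * r ^ β + exp (-ϑ * r) * g (u - v))
      (Set.Iic s) :=
    (hE.mul_const _).add (hg_int.integrableOn.const_mul _)
  have hle : ∀ v ∈ Set.Iic s, exp (-ϑ * (s - v)) * |u - v| ^ β ≤
      exp (-ϑ * (s - v)) * r ^ β + exp (-ϑ * r) * g (u - v) := by
    intro v hv
    rcases lt_or_ge |u - v| r with h | h
    · have hgv : g (u - v) = |u - v| ^ β := Set.indicator_of_mem (Set.mem_Iio.2 h) _
      have hsv : r ≤ s - v := by
        have h1 : |s - u| ≤ |s - v| + |u - v| := by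
          rw [abs_sub_comm u v]; exact abs_sub_le s v u
        rw [abs_of_nonneg (sub_nonneg.2 (Set.mem_Iic.1 hv))] at h1
        linarith
      have h2 : exp (-ϑ * (s - v)) ≤ exp (-ϑ * r) := exp_le_exp.2 (by nlinarith)
      rw [hgv]
      have h3 := mul_le_mul_of_nonneg_right h2 (rpow_nonneg (abs_nonneg (u - v)) β)
      have h4 : 0 ≤ exp (-ϑ * (s - v)) * r ^ β := by positivity
      linarith
    · have h1 := mul_le_mul_of_nonneg_left (rpow_le_rpow_of_nonpos hr h hβ0.le)
        (exp_nonneg (-ϑ * (s - v)))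
      have h2 := mul_nonneg (exp_nonneg (-ϑ * r)) (hg_nonneg (u - v))
      linarith
  have hint : IntegrableOn (fun v => exp (-ϑ * (s - v)) * |u - v| ^ β) (Set.Iic s) := by
    refine Integrable.mono' hM (Measurable.aestronglyMeasurable (by fun_prop)) ?_
    filter_upwards [ae_restrict_mem measurableSet_Iic] with v hv
    rw [norm_of_nonneg (mul_nonneg (exp_nonneg _) (rpow_nonneg (abs_nonneg _) _))]
    exact hle v hv
  refine ⟨hint, ?_⟩
  have hgle : ∫ v in Set.Iic s, g (u - v) ≤ 2 * (r ^ (β + 1) / (β + 1)) :=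
    hg_eq ▸ setIntegral_le_integral hg_int (Filter.Eventually.of_forall fun v => hg_nonneg _)
  have hre : exp (-ϑ * r) * r ≤ 1 / ϑ := by
    rw [le_div_iff₀ hϑ, neg_mul, exp_neg, mul_assoc, inv_mul_le_iff₀ (exp_pos _)]
    linarith [add_one_le_exp (ϑ * r)]
  have hrs : (1 / 2) ^ β * |s - u| ^ β = r ^ β := by
    rw [← mul_rpow (by norm_num) (abs_nonneg _)]
    congr 1
    ring
  have hβ1 : 0 < β + 1 := by linarith
  calc ∫ v in Set.Iic s, exp (-ϑ * (s - v)) * |u - v| ^ β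
      ≤ ∫ v in Set.Iic s, (exp (-ϑ * (s - v)) * r ^ β + exp (-ϑ * r) * g (u - v)) :=
        setIntegral_mono_on hint hM measurableSet_Iic hle
    _ = 1 / ϑ * r ^ β + exp (-ϑ * r) * ∫ v in Set.Iic s, g (u - v) := by
        rw [integral_add (hE.mul_const _) (hg_int.integrableOn.const_mul _), integral_mul_const,
          integral_const_mul, hE_eq]
    _ ≤ 1 / ϑ * r ^ β + exp (-ϑ * r) * (2 * (r ^ (β + 1) / (β + 1))) := by gcongr
    _ = 1 / ϑ * r ^ β + exp (-ϑ * r) * r * (2 / (β + 1) * r ^ β) := by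
        rw [rpow_add_one hr.ne']; ring
    _ ≤ 1 / ϑ * r ^ β + 1 / ϑ * (2 / (β + 1) * r ^ β) := by gcongr
    _ = (1 / 2) ^ β * (1 / ϑ * (1 + 2 / (β + 1))) * |s - u| ^ β := by rw [← hrs]; ring

lemma setIntegral_Ioc_exp_mul_abs_rpow_le {ϑ β : ℝ} (hϑ : 0 < ϑ) (hβ : -1 < β) (hβ0 : β < 0)
    (a : ℝ) {s u : ℝ} (hu : u ≠ s) :
    ∫ v in Set.Ioc a s, exp (-ϑ * (s - v)) * |u - v| ^ β ≤
      (1 / 2) ^ β * (1 / ϑ * (1 + 2 / (β + 1))) * |s - u| ^ β := by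
  obtain ⟨hint, hle⟩ := integral_exp_mul_abs_rpow_le_s13 hϑ hβ hβ0 hu
  refine le_trans (setIntegral_mono_set hint ?_ ?_) hle
  · exact Filter.Eventually.of_forall fun v => by
      simp only [Pi.zero_apply]; positivity
  · exact Set.Ioc_subset_Iic_self.eventuallyLE

theorem sfOU_cov_bound (ϑ H : ℝ) (hϑ : 0 < ϑ)
    (hH : H ∈ Set.Ioo (1 / 2 : ℝ) 1) :
    ∃ C : ℝ, 0 < C ∧ ∀ s t : ℝ, 0 ≤ s → s < t →
      (∫ u in (0 : ℝ)..t, ∫ v in (0 : ℝ)..s,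
          Real.exp (-ϑ * (t - u)) * Real.exp (-ϑ * (s - v)) *
            (H * (2 * H - 1) * (|u - v| ^ (2 * H - 2) - (u + v) ^ (2 * H - 2))))
        ≤ C * (t - s) ^ (2 * H - 2) := by
  obtain ⟨hH1, hH2⟩ := hH
  set β := 2 * H - 2 with hβ_def
  have hβ : -1 < β := by linarith
  have hβ0 : β < 0 := by linarith
  have hβ1 : 0 < β + 1 := by linarith
  set c := H * (2 * H - 1)
  have hc : 0 < c := mul_pos (by linarith) (by linarith)
  set K := (1 / 2) ^ β * (1 / ϑ * (1 + 2 / (β + 1)))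
  have hK : 0 < K := by positivity
  refine ⟨c * K * K, by positivity, fun s t hs hst => ?_⟩
  have ht : 0 ≤ t := hs.trans hst.le
  rw [intervalIntegral.integral_of_le ht]
  simp_rw [intervalIntegral.integral_of_le hs]
  have hnonneg : ∀ u ∈ Set.Ioc 0 t, ∀ᵐ v ∂volume.restrict (Set.Ioc 0 s),
      0 ≤ exp (-ϑ * (t - u)) * exp (-ϑ * (s - v)) * (c * (|u - v| ^ β - (u + v) ^ β)) := by
    intro u hu
    filter_upwards [ae_restrict_mem measurableSet_Ioc,
      ae_restrict_of_ae (Measure.ae_ne volume u)] with v hv hvu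
    have h1 : |u - v| ≤ u + v := abs_le.2 ⟨by linarith [hu.1], by linarith [hv.1]⟩
    have h2 := rpow_le_rpow_of_nonpos (abs_pos.2 (sub_ne_zero.2 (Ne.symm hvu))) h1 hβ0.le
    have h3 := sub_nonneg.2 h2
    positivity
  have hinner : ∀ u ∈ Set.Ioc 0 t, u ≠ s →
      ∫ v in Set.Ioc 0 s,
        exp (-ϑ * (t - u)) * exp (-ϑ * (s - v)) * (c * (|u - v| ^ β - (u + v) ^ β)) ≤
      c * K * (exp (-ϑ * (t - u)) * |s - u| ^ β) := by
    intro u hu hus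
    have hint := ((integral_exp_mul_abs_rpow_le_s13 hϑ hβ hβ0 hus).1.mono_set
      (Set.Ioc_subset_Iic_self (a := 0))).const_mul (c * exp (-ϑ * (t - u)))
    calc _ ≤ ∫ v in Set.Ioc 0 s,
            c * exp (-ϑ * (t - u)) * (exp (-ϑ * (s - v)) * |u - v| ^ β) := by
          refine integral_mono_of_nonneg (hnonneg u hu) hint ?_
          filter_upwards [ae_restrict_mem measurableSet_Ioc] with v hv
          have h1 : 0 ≤ (u + v) ^ β := rpow_nonneg (by linarith [hu.1, hv.1]) β
          have h2 : 0 ≤ exp (-ϑ * (t - u)) * exp (-ϑ * (s - v)) * (c * (u + v) ^ β) := by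
            positivity
          linarith
      _ = c * exp (-ϑ * (t - u)) *
            ∫ v in Set.Ioc 0 s, exp (-ϑ * (s - v)) * |u - v| ^ β := integral_const_mul _ _
      _ ≤ c * exp (-ϑ * (t - u)) * (K * |s - u| ^ β) := by
          gcongr
          exact setIntegral_Ioc_exp_mul_abs_rpow_le hϑ hβ hβ0 0 hus
      _ = _ := by ring
  have hint := ((integral_exp_mul_abs_rpow_le_s13 hϑ hβ hβ0 hst.ne).1.mono_set
    (Set.Ioc_subset_Iic_self (a := 0))).const_mul (c * K)
  calc _ ≤ ∫ u in Set.Ioc 0 t, c * K * (exp (-ϑ * (t - u)) * |s - u| ^ β) := by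
        refine integral_mono_of_nonneg ?_ hint ?_
        · filter_upwards [ae_restrict_mem measurableSet_Ioc] with u hu
          exact integral_nonneg_of_ae (hnonneg u hu)
        · filter_upwards [ae_restrict_mem measurableSet_Ioc,
            ae_restrict_of_ae (Measure.ae_ne volume s)] with u hu hus
          exact hinner u hu hus
    _ = c * K * ∫ u in Set.Ioc 0 t, exp (-ϑ * (t - u)) * |s - u| ^ β :=
        integral_const_mul _ _
    _ ≤ c * K * (K * |t - s| ^ β) := by
        gcongr
        exact setIntegral_Ioc_exp_mul_abs_rpow_le hϑ hβ hβ0 0 hst.ne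
    _ = c * K * K * (t - s) ^ β := by
        rw [abs_of_pos (sub_pos.2 hst)]; ring
end

section
/- Let ϑ > 0 and H ∈ (1/2,1). Then lim_{T→∞} (1/T) ∫₀^T [ H(2H−1) ∫₀^t ∫₀^t e^{−ϑ(2t−u−v)} (|u−v|^{2H−2} − (u+v)^{2H−2}) du dv ] dt = H ϑ^{−2H} Γ(2H). In particular, the variance of the sub-fractional Ornstein–Uhlenbeck process X_t^{(2)} = ∫₀^t e^{−ϑ(t−u)} dS^H_u satisfies (1/T) ∫₀^T E[(X_t^{(2)})²] dt → H ϑ^{−2H} Γ(2H). -/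
open Real MeasureTheory Filter

/-- The continuous Cesàro mean of a function converging at infinity has the same limit. -/
theorem tendsto_integral_average_of_tendsto {f : ℝ → ℝ} {L : ℝ}
    (hf : ∀ T, 0 ≤ T → IntervalIntegrable f volume 0 T) (hL : Tendsto f atTop (nhds L)) :
    Tendsto (fun T : ℝ => (1 / T) * ∫ t in (0 : ℝ)..T, f t) atTop (nhds L) := by
  rw [Metric.tendsto_atTop] at hL ⊢
  intro ε hε
  obtain ⟨N, hN⟩ := hL (ε / 2) (half_pos hε)
  set S := max N 1
  have hS : 0 < S := lt_of_lt_of_le one_pos (le_max_right _ _)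
  set C := |∫ t in (0 : ℝ)..S, (f t - L)|
  refine ⟨max S (2 * C / ε + 1), fun T hT => ?_⟩
  have hST : S ≤ T := le_trans (le_max_left _ _) hT
  have hT0 : 0 < T := hS.trans_le hST
  have hCT : C < T * (ε / 2) := by
    have h : 2 * C / ε < T := by linarith [le_trans (le_max_right S (2 * C / ε + 1)) hT]
    rw [div_lt_iff₀ hε] at h
    linarith
  have hi : ∀ T, 0 ≤ T → IntervalIntegrable (fun t => f t - L) volume 0 T :=
    fun T hT => (hf T hT).sub intervalIntegrable_const
  have hsplit := intervalIntegral.integral_add_adjacent_intervals (hi S hS.le)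
    ((hi S hS.le).symm.trans (hi T hT0.le))
  have htail : |∫ t in S..T, (f t - L)| ≤ ε / 2 * |T - S| := by
    refine intervalIntegral.norm_integral_le_of_norm_le_const (f := fun t => f t - L)
      fun t ht => ?_
    rw [Set.uIoc_of_le hST] at ht
    exact (hN t ((le_max_left _ _).trans ht.1.le)).le
  rw [abs_of_nonneg (by linarith : 0 ≤ T - S)] at htail
  have hmean : (1 / T) * (∫ t in (0 : ℝ)..T, f t) - L
      = (1 / T) * ∫ t in (0 : ℝ)..T, (f t - L) := by
    rw [intervalIntegral.integral_sub (hf T hT0.le) intervalIntegrable_const]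
    simp
    field_simp
  rw [Real.dist_eq, hmean, abs_mul, abs_of_pos (by positivity), ← hsplit, one_div,
    inv_mul_lt_iff₀ hT0]
  have := abs_add_le (∫ t in (0 : ℝ)..S, (f t - L)) (∫ t in S..T, (f t - L))
  nlinarith

/-- An integrable function on a square has iterated interval integrals equal to its integral. -/
theorem intervalIntegral_intervalIntegral_eq_setIntegral_Ioo_prod {f : ℝ → ℝ → ℝ} {t : ℝ}
    (ht : 0 ≤ t) (hf : IntegrableOn (Function.uncurry f) (Set.Ioo 0 t ×ˢ Set.Ioo 0 t)) :
    ∫ u in (0 : ℝ)..t, ∫ v in (0 : ℝ)..t, f u v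
      = ∫ z in Set.Ioo 0 t ×ˢ Set.Ioo 0 t, Function.uncurry f z := by
  rw [Measure.volume_eq_prod] at hf ⊢
  rw [setIntegral_prod _ hf]
  simp only [intervalIntegral.integral_of_le ht, integral_Ioc_eq_integral_Ioo,
    Function.uncurry_apply_pair]

/-- The exponentially weighted singular kernel on the positive quadrant. -/
noncomputable def expAbsSubKernel (ϑ r : ℝ) : ℝ × ℝ → ℝ :=
  (Set.Ioi 0 ×ˢ Set.Ioi 0).indicator fun z => exp (-ϑ * (z.1 + z.2)) * |z.1 - z.2| ^ r

theorem expAbsSubKernel_nonneg (ϑ r : ℝ) (z : ℝ × ℝ) : 0 ≤ expAbsSubKernel ϑ r z :=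
  Set.indicator_nonneg (fun _ _ => by positivity) z

theorem integrable_expAbsSubKernel_and_integral {ϑ r : ℝ} (hϑ : 0 < ϑ) (hr : -1 < r)
    (hr0 : r ≠ 0) :
    Integrable (expAbsSubKernel ϑ r) ∧
      ∫ z, expAbsSubKernel ϑ r z = (1 / ϑ) * ((1 / ϑ) ^ (r + 1) * Gamma (r + 1)) := by
  set p : ℝ → ℝ := (Set.Ioi 0).indicator fun x => exp (-(2 * ϑ) * x) with hp
  set q : ℝ → ℝ := (Set.Ioi 0).indicator fun x => x ^ r * exp (-(ϑ * x)) with hq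
  have hpi : Integrable p :=
    (integrable_indicator_iff measurableSet_Ioi).2 (integrableOn_exp_mul_Ioi (by linarith) 0)
  have hqi : Integrable q := by
    refine (integrable_indicator_iff measurableSet_Ioi).2 ?_
    simpa using integrableOn_rpow_mul_exp_neg_mul_rpow hr one_pos hϑ
  have hpv : ∫ x, p x = 1 / (2 * ϑ) := by
    rw [hp, integral_indicator measurableSet_Ioi, integral_exp_mul_Ioi (by linarith)]
    simp
  have hqv : ∫ x, q x = (1 / ϑ) ^ (r + 1) * Gamma (r + 1) := by
    rw [hq, integral_indicator measurableSet_Ioi,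
      ← integral_rpow_mul_exp_neg_mul_Ioi (by linarith) hϑ]
    simp
  set K : ℝ × ℝ → ℝ := fun z => p z.2 * q (z.1 - z.2) with hK
  have hKi : Integrable K (volume.prod volume) :=
    hpi.convolution_integrand (ContinuousLinearMap.mul ℝ ℝ) hqi
  have hKv : ∫ z, K z ∂(volume.prod volume)
      = 1 / (2 * ϑ) * ((1 / ϑ) ^ (r + 1) * Gamma (r + 1)) := by
    rw [integral_prod _ hKi, ← hpv, ← hqv]
    exact integral_convolution (ContinuousLinearMap.mul ℝ ℝ) hpi hqi
  have hsum : expAbsSubKernel ϑ r = fun z => K z + K z.swap := by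
    funext ⟨x, y⟩
    simp only [expAbsSubKernel, hK, hp, hq, Set.indicator_apply, Set.mem_prod, Set.mem_Ioi,
      Prod.swap, sub_pos]
    rcases lt_trichotomy x y with h | h | h
    · by_cases hx : 0 < x
      · simp only [hx, hx.trans h, h, h.not_gt, and_self, if_true, if_false, mul_zero, zero_add]
        rw [abs_sub_comm, abs_of_pos (sub_pos.2 h), mul_left_comm, ← exp_add, mul_comm]
        ring_nf
      · simp [hx, h.not_gt]
    · subst h
      simp [hr0]
    · by_cases hy : 0 < y
      · simp only [hy, hy.trans h, h, h.not_gt, and_self, if_true, if_false, mul_zero, add_zero]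
        rw [abs_of_pos (sub_pos.2 h), mul_left_comm, ← exp_add, mul_comm]
        ring_nf
      · simp [hy, h.not_gt]
  rw [hsum, Measure.volume_eq_prod]
  refine ⟨hKi.add hKi.swap, ?_⟩
  refine (integral_add hKi hKi.swap).trans ?_
  have : ∫ z : ℝ × ℝ, (K ∘ Prod.swap) z ∂(volume.prod volume)
      = ∫ z, K z ∂(volume.prod volume) := integral_prod_swap K
  rw [this, hKv]
  field_simp
  ring

theorem monotone_Ioo_prod_Ioo : Monotone fun t : ℝ => Set.Ioo 0 t ×ˢ Set.Ioo 0 t :=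
  fun _ _ h => Set.prod_mono (Set.Ioo_subset_Ioo_right h) (Set.Ioo_subset_Ioo_right h)

theorem tendsto_setIntegral_expAbsSubKernel {ϑ r : ℝ} (hϑ : 0 < ϑ) (hr : -1 < r) (hr0 : r ≠ 0) :
    Tendsto (fun t : ℝ => ∫ z in Set.Ioo 0 t ×ˢ Set.Ioo 0 t, expAbsSubKernel ϑ r z) atTop
      (nhds ((1 / ϑ) * ((1 / ϑ) ^ (r + 1) * Gamma (r + 1)))) := by
  obtain ⟨hi, hv⟩ := integrable_expAbsSubKernel_and_integral hϑ hr hr0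
  have h := tendsto_setIntegral_of_monotone (f := expAbsSubKernel ϑ r) (μ := volume)
    (fun t : ℝ => (measurableSet_Ioo (a := (0 : ℝ)) (b := t)).prod
      (measurableSet_Ioo (a := (0 : ℝ)) (b := t))) monotone_Ioo_prod_Ioo hi.integrableOn
  rwa [setIntegral_eq_integral_of_forall_compl_eq_zero, hv] at h
  intro z hz
  refine Set.indicator_of_notMem (fun hz' => hz ?_) _
  refine Set.mem_iUnion.2 ⟨max z.1 z.2 + 1, ⟨hz'.1, ?_⟩, ⟨hz'.2, ?_⟩⟩
  · linarith [le_max_left z.1 z.2]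
  · linarith [le_max_right z.1 z.2]

theorem monotone_setIntegral_expAbsSubKernel {ϑ r : ℝ} (hϑ : 0 < ϑ) (hr : -1 < r) (hr0 : r ≠ 0) :
    Monotone fun t : ℝ => ∫ z in Set.Ioo 0 t ×ˢ Set.Ioo 0 t, expAbsSubKernel ϑ r z :=
  fun _ _ h => setIntegral_mono_set
    (integrable_expAbsSubKernel_and_integral hϑ hr hr0).1.integrableOn
    (ae_of_all _ (expAbsSubKernel_nonneg ϑ r)) (monotone_Ioo_prod_Ioo h).eventuallyLE

theorem exp_mul_abs_sub_rpow_eq_kernel {ϑ r t : ℝ} {z : ℝ × ℝ}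
    (hz : z ∈ Set.Ioo 0 t ×ˢ Set.Ioo 0 t) :
    exp (-ϑ * (2 * t - z.1 - z.2)) * |z.1 - z.2| ^ r = expAbsSubKernel ϑ r ((t, t) - z) := by
  obtain ⟨⟨_, h1⟩, ⟨_, h2⟩⟩ := hz
  have hmem : (t, t) - z ∈ Set.Ioi (0 : ℝ) ×ˢ Set.Ioi (0 : ℝ) := ⟨sub_pos.2 h1, sub_pos.2 h2⟩
  rw [expAbsSubKernel, Set.indicator_of_mem hmem]
  simp only [Prod.fst_sub, Prod.snd_sub]
  rw [abs_sub_comm z.1 z.2]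
  ring_nf

theorem integrableOn_exp_mul_abs_sub_rpow {ϑ r : ℝ} (hϑ : 0 < ϑ) (hr : -1 < r) (hr0 : r ≠ 0)
    (t : ℝ) :
    IntegrableOn (fun z : ℝ × ℝ => exp (-ϑ * (2 * t - z.1 - z.2)) * |z.1 - z.2| ^ r)
      (Set.Ioo 0 t ×ˢ Set.Ioo 0 t) :=
  (((integrable_expAbsSubKernel_and_integral hϑ hr hr0).1.comp_sub_left (t, t)).integrableOn
    ).congr_fun (fun _ hz => (exp_mul_abs_sub_rpow_eq_kernel hz).symm)
    (measurableSet_Ioo.prod measurableSet_Ioo)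

theorem setIntegral_exp_mul_abs_sub_rpow (ϑ r t : ℝ) :
    ∫ z in Set.Ioo 0 t ×ˢ Set.Ioo 0 t, exp (-ϑ * (2 * t - z.1 - z.2)) * |z.1 - z.2| ^ r
      = ∫ z in Set.Ioo 0 t ×ˢ Set.Ioo 0 t, expAbsSubKernel ϑ r z := by
  have hm : MeasurableSet (Set.Ioo (0 : ℝ) t ×ˢ Set.Ioo (0 : ℝ) t) :=
    measurableSet_Ioo.prod measurableSet_Ioo
  rw [setIntegral_congr_fun hm fun _ hz => exp_mul_abs_sub_rpow_eq_kernel hz,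
    ← integral_indicator hm, ← integral_indicator hm,
    ← integral_sub_left_eq_self _ volume ((t, t) : ℝ × ℝ)]
  congr 1
  funext z
  simp only [Set.indicator_apply, Set.mem_prod, Set.mem_Ioo, Prod.fst_sub, Prod.snd_sub, sub_pos,
    sub_lt_self_iff]
  congr 1
  · exact propext ⟨fun h => ⟨h.1.symm, h.2.symm⟩, fun h => ⟨h.1.symm, h.2.symm⟩⟩
  · rw [sub_sub_cancel]

theorem integrableOn_exp_mul_add_rpow {ϑ r : ℝ} (hϑ : 0 < ϑ) (hr : -1 < r) (hr0 : r < 0)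
    (t : ℝ) :
    IntegrableOn (fun z : ℝ × ℝ => exp (ϑ * (z.1 + z.2)) * (z.1 + z.2) ^ r)
      (Set.Ioo 0 t ×ˢ Set.Ioo 0 t) := by
  have h1 : IntegrableOn (fun u : ℝ => u ^ r) (Set.Ioo 0 t) := by
    rcases le_or_gt t 0 with h | h
    · simp [Set.Ioo_eq_empty_of_le h]
    · exact (intervalIntegral.integrableOn_Ioo_rpow_iff h).2 hr
  have h2 : IntegrableOn (fun _ : ℝ => exp (ϑ * (2 * t))) (Set.Ioo 0 t) :=
    integrableOn_const (by simp)
  have h3 : IntegrableOn (fun z : ℝ × ℝ => z.1 ^ r * exp (ϑ * (2 * t)))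
      (Set.Ioo 0 t ×ˢ Set.Ioo 0 t) := by
    rw [IntegrableOn, Measure.volume_eq_prod, ← Measure.prod_restrict]
    exact h1.mul_prod h2
  refine Integrable.mono' h3 (by fun_prop) ?_
  filter_upwards [ae_restrict_mem (measurableSet_Ioo.prod measurableSet_Ioo)] with z hz
  obtain ⟨⟨hu, hut⟩, ⟨hv, hvt⟩⟩ := hz
  rw [norm_of_nonneg (by positivity), mul_comm]
  have : (z.1 + z.2) ^ r ≤ z.1 ^ r := rpow_le_rpow_of_nonpos hu (by linarith) hr0.le
  gcongr
  linarith

theorem exp_mul_add_rpow_factor (ϑ r t : ℝ) (z : ℝ × ℝ) :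
    exp (-ϑ * (2 * t - z.1 - z.2)) * (z.1 + z.2) ^ r
      = exp (-ϑ * (2 * t)) * (exp (ϑ * (z.1 + z.2)) * (z.1 + z.2) ^ r) := by
  rw [← mul_assoc, ← exp_add]
  ring_nf

theorem integral_Ioo_exp_neg_mul_sub_le {ϑ t : ℝ} (hϑ : 0 < ϑ) (ht : 0 ≤ t) :
    ∫ v in Set.Ioo 0 t, exp (-ϑ * (t - v)) ≤ 1 / ϑ := by
  rw [← integral_Ioc_eq_integral_Ioo, ← intervalIntegral.integral_of_le ht,
    intervalIntegral.integral_comp_sub_left (fun x => exp (-ϑ * x)), sub_self, sub_zero,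
    intervalIntegral.integral_of_le ht]
  calc ∫ x in Set.Ioc 0 t, exp (-ϑ * x) ≤ ∫ x in Set.Ioi 0, exp (-ϑ * x) :=
        setIntegral_mono_set (integrableOn_exp_mul_Ioi (by linarith) 0)
          (ae_of_all _ fun _ => (exp_pos _).le) Set.Ioc_subset_Ioi_self.eventuallyLE
    _ = 1 / ϑ := by
        rw [integral_exp_mul_Ioi (by linarith)]
        simp

theorem tendsto_setIntegral_exp_mul_add_rpow {ϑ r : ℝ} (hϑ : 0 < ϑ) (hr : -1 < r) (hr0 : r < 0) :
    Tendsto (fun t : ℝ => ∫ z in Set.Ioo 0 t ×ˢ Set.Ioo 0 t,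
      exp (-ϑ * (2 * t - z.1 - z.2)) * (z.1 + z.2) ^ r) atTop (nhds 0) := by
  have hb : Tendsto (fun t : ℝ => (exp (-(ϑ / 2) * t) * (t ^ (r + 1) / (r + 1)) +
      (t / 2) ^ r * (1 / ϑ)) * (1 / ϑ)) atTop (nhds 0) := by
    have e1 : Tendsto (fun t : ℝ => t ^ (r + 1) * exp (-(ϑ / 2) * t)) atTop (nhds 0) :=
      tendsto_rpow_mul_exp_neg_mul_atTop_nhds_zero _ _ (half_pos hϑ)
    have e2 : Tendsto (fun t : ℝ => (t / 2) ^ r) atTop (nhds 0) := by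
      have := (tendsto_rpow_neg_atTop (neg_pos.2 hr0)).comp
        (tendsto_id.atTop_div_const (two_pos : (0 : ℝ) < 2))
      simpa [Function.comp_def] using this
    have := ((e1.div_const (r + 1)).add (e2.mul_const (1 / ϑ))).mul_const (1 / ϑ)
    simp only [zero_div, zero_mul, add_zero] at this
    refine this.congr fun t => ?_
    ring
  refine squeeze_zero' (Eventually.of_forall fun t => ?_) ?_ hb
  · refine setIntegral_nonneg (measurableSet_Ioo.prod measurableSet_Ioo) fun z hz => ?_
    have := hz.1.1
    have := hz.2.1
    positivity
  filter_upwards [eventually_gt_atTop 0] with t ht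
  set g : ℝ → ℝ := fun u =>
    exp (-(ϑ / 2) * t) * u ^ r + (t / 2) ^ r * exp (-ϑ * (t - u)) with hg
  have hrpow : IntegrableOn (fun u : ℝ => u ^ r) (Set.Ioo 0 t) :=
    (intervalIntegral.integrableOn_Ioo_rpow_iff ht).2 hr
  have hexp : IntegrableOn (fun u : ℝ => exp (-ϑ * (t - u))) (Set.Ioo 0 t) :=
    (Continuous.integrableOn_Icc (by fun_prop)).mono_set Set.Ioo_subset_Icc_self
  have hgi : IntegrableOn g (Set.Ioo 0 t) := (hrpow.const_mul _).add (hexp.const_mul _)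
  have hgv : ∫ u in Set.Ioo 0 t, g u ≤
      exp (-(ϑ / 2) * t) * (t ^ (r + 1) / (r + 1)) + (t / 2) ^ r * (1 / ϑ) := by
    rw [hg, integral_add (hrpow.const_mul _) (hexp.const_mul _), integral_const_mul,
      integral_const_mul]
    refine add_le_add (le_of_eq ?_)
      (mul_le_mul_of_nonneg_left (integral_Ioo_exp_neg_mul_sub_le hϑ ht.le) (by positivity))
    rw [← integral_Ioc_eq_integral_Ioo, ← intervalIntegral.integral_of_le ht.le,
      integral_rpow (Or.inl hr), zero_rpow (by linarith), sub_zero]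
  have hgn : 0 ≤ ∫ u in Set.Ioo 0 t, g u :=
    setIntegral_nonneg measurableSet_Ioo fun u hu => by
      have := hu.1
      positivity
  calc ∫ z in Set.Ioo 0 t ×ˢ Set.Ioo 0 t, exp (-ϑ * (2 * t - z.1 - z.2)) * (z.1 + z.2) ^ r
      ≤ ∫ z in Set.Ioo 0 t ×ˢ Set.Ioo 0 t, g z.1 * exp (-ϑ * (t - z.2)) := by
        refine setIntegral_mono_on ?_ ?_ (measurableSet_Ioo.prod measurableSet_Ioo) ?_
        · simp only [exp_mul_add_rpow_factor]
          exact (integrableOn_exp_mul_add_rpow hϑ hr hr0 t).const_mul _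
        · rw [IntegrableOn, Measure.volume_eq_prod, ← Measure.prod_restrict]
          exact hgi.mul_prod hexp
        · rintro ⟨u, v⟩ ⟨⟨hu, hut⟩, ⟨hv, hvt⟩⟩
          simp only at hu hut hv hvt ⊢
          have hsplit : exp (-ϑ * (2 * t - u - v)) = exp (-ϑ * (t - u)) * exp (-ϑ * (t - v)) := by
            rw [← exp_add]
            ring_nf
          rw [hsplit, mul_right_comm]
          refine mul_le_mul_of_nonneg_right ?_ (exp_pos _).le
          have hle : (u + v) ^ r ≤ u ^ r := rpow_le_rpow_of_nonpos hu (by linarith) hr0.le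
          refine (mul_le_mul_of_nonneg_left hle (exp_pos _).le).trans ?_
          rcases le_total u (t / 2) with h | h
          · have : exp (-ϑ * (t - u)) ≤ exp (-(ϑ / 2) * t) := exp_le_exp.2 (by nlinarith)
            exact le_add_of_le_of_nonneg (by gcongr) (by positivity)
          · have : u ^ r ≤ (t / 2) ^ r := rpow_le_rpow_of_nonpos (half_pos ht) h hr0.le
            refine le_add_of_nonneg_of_le (by positivity) ?_
            rw [mul_comm]
            gcongr
    _ = (∫ u in Set.Ioo 0 t, g u) * ∫ v in Set.Ioo 0 t, exp (-ϑ * (t - v)) := by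
        rw [Measure.volume_eq_prod, setIntegral_prod_mul g fun v => exp (-ϑ * (t - v))]
    _ ≤ _ := by
        have h1 := integral_Ioo_exp_neg_mul_sub_le hϑ ht.le
        have h2 := hgn.trans hgv
        calc _ ≤ (∫ u in Set.Ioo 0 t, g u) * (1 / ϑ) := by gcongr
          _ ≤ _ := by gcongr

theorem intervalIntegrable_setIntegral_exp_mul_add_rpow {ϑ r : ℝ} (hϑ : 0 < ϑ) (hr : -1 < r)
    (hr0 : r < 0) (a b : ℝ) :
    IntervalIntegrable (fun t : ℝ => ∫ z in Set.Ioo 0 t ×ˢ Set.Ioo 0 t,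
      exp (-ϑ * (2 * t - z.1 - z.2)) * (z.1 + z.2) ^ r) volume a b := by
  have hmono : Monotone fun t : ℝ => ∫ z in Set.Ioo 0 t ×ˢ Set.Ioo 0 t,
      exp (ϑ * (z.1 + z.2)) * (z.1 + z.2) ^ r := fun s t h => by
    refine setIntegral_mono_set (integrableOn_exp_mul_add_rpow hϑ hr hr0 t) ?_
      (monotone_Ioo_prod_Ioo h).eventuallyLE
    filter_upwards [ae_restrict_mem (measurableSet_Ioo.prod measurableSet_Ioo)] with z hz
    have := hz.1.1
    have := hz.2.1
    exact mul_nonneg (exp_pos _).le (rpow_nonneg (by linarith) _)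
  simp only [exp_mul_add_rpow_factor, integral_const_mul]
  exact hmono.intervalIntegrable.continuousOn_mul (by fun_prop)

theorem sfOU_variance_ergodic_limit (ϑ H : ℝ) (hϑ : 0 < ϑ)
    (hH : H ∈ Set.Ioo (1 / 2 : ℝ) 1) :
    Tendsto (fun T : ℝ =>
        (1 / T) * ∫ t in (0 : ℝ)..T,
          H * (2 * H - 1) * ∫ u in (0 : ℝ)..t, ∫ v in (0 : ℝ)..t,
            Real.exp (-ϑ * (2 * t - u - v)) *
              (|u - v| ^ (2 * H - 2) - (u + v) ^ (2 * H - 2)))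
      atTop (nhds (H * ϑ ^ (-(2 * H)) * Real.Gamma (2 * H))) := by
  obtain ⟨hH1, hH2⟩ := hH
  set r := 2 * H - 2 with hrdef
  have hr : -1 < r := by linarith
  have hr0 : r < 0 := by linarith
  set G : ℝ → ℝ := fun t => ∫ z in Set.Ioo 0 t ×ˢ Set.Ioo 0 t, expAbsSubKernel ϑ r z
  set R : ℝ → ℝ := fun t => ∫ z in Set.Ioo 0 t ×ˢ Set.Ioo 0 t,
    exp (-ϑ * (2 * t - z.1 - z.2)) * (z.1 + z.2) ^ r
  have hGR : ∀ t, 0 ≤ t → ∫ u in (0 : ℝ)..t, ∫ v in (0 : ℝ)..t,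
      exp (-ϑ * (2 * t - u - v)) * (|u - v| ^ r - (u + v) ^ r) = G t - R t := by
    intro t ht
    have hA := integrableOn_exp_mul_abs_sub_rpow hϑ hr hr0.ne t
    have hB : IntegrableOn (fun z : ℝ × ℝ => exp (-ϑ * (2 * t - z.1 - z.2)) * (z.1 + z.2) ^ r)
        (Set.Ioo 0 t ×ˢ Set.Ioo 0 t) := by
      simp only [exp_mul_add_rpow_factor]
      exact (integrableOn_exp_mul_add_rpow hϑ hr hr0 t).const_mul _
    have heq : Function.uncurry (fun u v : ℝ =>
        exp (-ϑ * (2 * t - u - v)) * (|u - v| ^ r - (u + v) ^ r)) = fun z : ℝ × ℝ =>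
          exp (-ϑ * (2 * t - z.1 - z.2)) * |z.1 - z.2| ^ r -
            exp (-ϑ * (2 * t - z.1 - z.2)) * (z.1 + z.2) ^ r := by
      funext z
      simp only [Function.uncurry, mul_sub]
    rw [intervalIntegral_intervalIntegral_eq_setIntegral_Ioo_prod ht (by
      rw [heq]
      exact hA.sub hB), heq, integral_sub hA hB, setIntegral_exp_mul_abs_sub_rpow]
  have hlim : Tendsto (fun t => H * (2 * H - 1) * (G t - R t)) atTop
      (nhds (H * ϑ ^ (-(2 * H)) * Gamma (2 * H))) := by
    have h := ((tendsto_setIntegral_expAbsSubKernel hϑ hr hr0.ne).sub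
      (tendsto_setIntegral_exp_mul_add_rpow hϑ hr hr0)).const_mul (H * (2 * H - 1))
    convert! h using 2
    have hr1 : r + 1 = 2 * H - 1 := by ring
    have hΓ : Gamma (2 * H) = (2 * H - 1) * Gamma (2 * H - 1) := by
      rw [← Gamma_add_one (by linarith)]
      ring_nf
    have hpow : ϑ ^ (-(2 * H)) = (1 / ϑ) * (1 / ϑ) ^ (2 * H - 1) := by
      rw [one_div, inv_rpow hϑ.le, ← rpow_neg hϑ.le, ← rpow_neg_one ϑ, ← rpow_add hϑ]
      ring_nf
    rw [hr1, hΓ, hpow]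
    ring
  refine (tendsto_integral_average_of_tendsto (fun T _ => ?_) hlim).congr' ?_
  · exact ((monotone_setIntegral_expAbsSubKernel hϑ hr hr0.ne).intervalIntegrable.sub
      (intervalIntegrable_setIntegral_exp_mul_add_rpow hϑ hr hr0 0 T)).const_mul _
  · filter_upwards [eventually_ge_atTop 0] with T hT
    congr 1
    refine intervalIntegral.integral_congr fun t ht => ?_
    rw [Set.uIcc_of_le hT] at ht
    simp only [hGR t ht.1]
end
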